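/- arXiv:2006.07977 — 6 statements merged into one kernel-verified Lean document; each statement's English description precedes it below -/
import Mathlib

section
/- Let R and S be ceers and let f : ℕ → ℕ be a computable function. Then f induces an isomorphism from R to S (i.e., f is a reduction from R to S whose range meets every S-equivalence class) if and only if f has an equivalence inverse, i.e., there is a computable function g that is a reduction from S to R such that g(f(x)) is R-equivalent to x for every x, and f(g(x)) is S-equivalent to x for every x. -/
/-- A relation on ℕ is computably enumerable (as a set of pairs). -/
def CeRel (E : ℕ → ℕ → Prop) : Prop :=
  Partrec fun p : ℕ × ℕ => Part.assert (E p.1 p.2) fun _ => Part.some 0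

/-- A ceer: a computably enumerable equivalence relation on ℕ. -/
def Ceer (E : ℕ → ℕ → Prop) : Prop := Equivalence E ∧ CeRel E

/-- A total computably enumerable relation has a computable choice function. -/
theorem REPred.exists_computable_choice {p : ℕ × ℕ → Prop} (hp : REPred p)
    (htotal : ∀ z, ∃ x, p (x, z)) : ∃ g : ℕ → ℕ, Computable g ∧ ∀ z, p (g z, z) := by
  obtain ⟨c, hc⟩ := Nat.Partrec.Code.exists_code.1 hp
  have hdom (a : ℕ × ℕ) : (c.eval (Encodable.encode a)).Dom ↔ p a := by
    simp only [hc, Encodable.encodek, Part.coe_some, Part.bind_some]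
    simp [Part.assert]
  let s (z k : ℕ) : Option ℕ :=
    (c.evaln k.unpair.2 (Encodable.encode (k.unpair.1, z))).map fun _ => k.unpair.1
  have hs : Computable₂ s := by
    have hk : Primrec fun q : ℕ × ℕ => q.2.unpair := Primrec.unpair.comp Primrec.snd
    have hx : Primrec fun q : ℕ × ℕ => q.2.unpair.1 := Primrec.fst.comp hk
    refine Primrec.to_comp (Primrec.option_map
      (Nat.Partrec.Code.primrec_evaln.comp
        (((Primrec.snd.comp hk).pair (Primrec.const c)).pair
          (Primrec.encode.comp (hx.pair Primrec.fst)))) (hx.comp Primrec.fst).to₂)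
  have hsearch (z : ℕ) : (Nat.rfindOpt (s z)).Dom := by
    obtain ⟨x, hx⟩ := htotal z
    obtain ⟨y, hy⟩ := Part.dom_iff_mem.1 ((hdom (x, z)).2 hx)
    obtain ⟨m, hm⟩ := Nat.Partrec.Code.evaln_complete.1 hy
    refine Nat.rfindOpt_dom.2 ⟨Nat.pair x m, x, ?_⟩
    simp only [s, Nat.unpair_pair, Option.mem_def, Option.map_eq_some_iff]
    exact ⟨y, hm, trivial⟩
  refine ⟨fun z => (Nat.rfindOpt (s z)).get (hsearch z),
    (Partrec.rfindOpt hs).of_eq fun z => (Part.some_get (hsearch z)).symm, fun z => ?_⟩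
  obtain ⟨k, hk⟩ := Nat.rfindOpt_spec (Part.get_mem (hsearch z))
  obtain ⟨y, hy, hxy⟩ := Option.map_eq_some_iff.1 hk
  change p ((Nat.rfindOpt (s z)).get (hsearch z), z)
  rw [← hxy]
  exact (hdom _).1 (Part.dom_iff_mem.2 ⟨y, Nat.Partrec.Code.evaln_sound hy⟩)

/-- A computably enumerable relation is computably enumerable as a predicate on pairs. -/
theorem CeRel.rePred {E : ℕ → ℕ → Prop} (hE : CeRel E) :
    REPred fun p : ℕ × ℕ => E p.1 p.2 :=
  hE.dom_re.of_eq fun p => by simp [Part.assert]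

/-- **Inversion Lemma.** For ceers `R`, `S`, a computable `f` induces an isomorphism
from `R` to `S` (it is a reduction whose range meets every `S`-class) iff `f` has an
equivalence inverse. -/
theorem stmt_0 (R S : ℕ → ℕ → Prop) (hR : Ceer R) (hS : Ceer S)
    (f : ℕ → ℕ) (hf : Computable f) :
    ((∀ x y, R x y ↔ S (f x) (f y)) ∧ ∀ z, ∃ x, S (f x) z) ↔
      ∃ g : ℕ → ℕ, Computable g ∧ (∀ x y, S x y ↔ R (g x) (g y)) ∧
        (∀ x, R (g (f x)) x) ∧ (∀ x, S (f (g x)) x) := by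
  obtain ⟨hR, -⟩ := hR
  obtain ⟨hS, hSce⟩ := hS
  constructor
  · rintro ⟨hred, hsurj⟩
    have hre : REPred fun p : ℕ × ℕ => S (f p.1) p.2 :=
      Partrec.comp hSce.rePred ((hf.comp Computable.fst).pair Computable.snd)
    obtain ⟨g, hg, hfg⟩ := hre.exists_computable_choice hsurj
    refine ⟨g, hg, fun x y => ?_, fun x => (hred _ _).2 (hfg (f x)), hfg⟩
    rw [hred]
    exact ⟨fun h => hS.trans (hfg x) (hS.trans h (hS.symm (hfg y))),
      fun h => hS.trans (hS.symm (hfg x)) (hS.trans h (hfg y))⟩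
  · rintro ⟨g, -, hred, hgf, hfg⟩
    refine ⟨fun x y => ?_, fun z => ⟨g z, hfg z⟩⟩
    rw [hred]
    exact ⟨fun h => hR.trans (hgf x) (hR.trans h (hR.symm (hgf y))),
      fun h => hR.trans (hR.symm (hgf x)) (hR.trans h (hgf y))⟩
end

section
/- Let R and S be ceers such that every R-equivalence class and every S-equivalence class is an infinite set. Then R is isomorphic to S if and only if R is strongly isomorphic to S (the nontrivial direction being that an isomorphism can be improved to a computable permutation of ℕ, by a back-and-forth argument as in the Myhill Isomorphism Theorem). -/
/-- `R` is isomorphic to `S`: there is a computable reduction from `R` to `S` whose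
range meets every `S`-equivalence class. -/
def CeerIso (R S : ℕ → ℕ → Prop) : Prop :=
  ∃ f : ℕ → ℕ, Computable f ∧ (∀ x y, R x y ↔ S (f x) (f y)) ∧ ∀ z, ∃ x, S (f x) z

/-- `R` is strongly isomorphic to `S`: some computable permutation of ℕ reduces `R` to `S`. -/
def CeerStrongIso (R S : ℕ → ℕ → Prop) : Prop :=
  ∃ f : ℕ → ℕ, Computable f ∧ Function.Bijective f ∧ ∀ x y, R x y ↔ S (f x) (f y)

/-- A recursively enumerable predicate is the projection of a computable relation. -/
theorem REPred.exists_computable_witness {α : Type*} [Primcodable α] {p : α → Prop}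
    (hp : REPred p) :
    ∃ t : α → ℕ → Bool, Computable₂ t ∧ ∀ a, p a ↔ ∃ k, t a k = true := by
  obtain ⟨c, hc⟩ := Nat.Partrec.Code.exists_code.1 hp
  refine ⟨fun a k => (c.evaln k (Encodable.encode a)).isSome, ?_, fun a => ?_⟩
  · have h : Primrec fun q : α × ℕ => c.evaln q.2 (Encodable.encode q.1) :=
      Nat.Partrec.Code.primrec_evaln.comp
        ((Primrec.snd.pair (Primrec.const c)).pair (Primrec.encode.comp Primrec.fst))
    exact (Primrec.option_isSome.comp h).to_comp
  · have h : p a ↔ (c.eval (Encodable.encode a)).Dom := by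
      simp [hc, Part.assert]
    rw [h, Part.dom_iff_mem]
    simp only [Nat.Partrec.Code.evaln_complete, Option.isSome_iff_exists, Option.mem_def]
    exact exists_comm

namespace BackAndForth

/-- Two pairs are compatible if together they form the graph of a partial injection. -/
def Compat (p q : ℕ × ℕ) : Prop := p.1 = q.1 ↔ p.2 = q.2

instance : DecidableRel Compat := fun _ _ => inferInstanceAs (Decidable (_ ↔ _))

theorem Compat.symm {p q : ℕ × ℕ} (h : Compat p q) : Compat q p := by
  unfold Compat at *; rw [eq_comm, h, eq_comm]

/-- The coordinate handled at stage `n`: the first one at even stages, the second one at odd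
stages. -/
def side (n : ℕ) (p : ℕ × ℕ) : ℕ := bif n.bodd then p.2 else p.1

/-- The pair coded by `m`; the second component of `m` is left for a witness. -/
def cand (m : ℕ) : ℕ × ℕ := m.unpair.1.unpair

/-- Whether `m` codes a pair, with a witness for `t`, that meets the requirement of stage `s.1` and
is compatible with all pairs in `s.2`. -/
def good (t : ℕ × ℕ → ℕ → Bool) (s : ℕ × List (ℕ × ℕ)) (m : ℕ) : Bool :=
  t (cand m) m.unpair.2 &&
    (decide (side s.1 (cand m) = s.1.div2) && decide (∀ q ∈ s.2, Compat q (cand m)))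

/-- One stage of the construction. -/
def step (t : ℕ × ℕ → ℕ → Bool) (s : ℕ × List (ℕ × ℕ)) : Part (List (ℕ × ℕ)) :=
  (Nat.rfind fun m => Part.some (good t s m)).map fun m => cand m :: s.2

/-- The list of pairs chosen before stage `n`. -/
def stage (t : ℕ × ℕ → ℕ → Bool) (n : ℕ) : Part (List (ℕ × ℕ)) :=
  n.rec (Part.some []) fun k L => L.bind fun l => step t (k, l)

theorem primrecRel_compat : PrimrecRel Compat := by
  have h₁ : Primrec₂ fun p q : ℕ × ℕ => decide (p.1 = q.1) :=
    (Primrec.eq.comp (Primrec.fst.comp Primrec.fst) (Primrec.fst.comp Primrec.snd)).decide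
  have h₂ : Primrec₂ fun p q : ℕ × ℕ => decide (p.2 = q.2) :=
    (Primrec.eq.comp (Primrec.snd.comp Primrec.fst) (Primrec.snd.comp Primrec.snd)).decide
  have h : PrimrecRel fun p q : ℕ × ℕ => decide (p.1 = q.1) = decide (p.2 = q.2) :=
    Primrec.eq.comp h₁ h₂
  exact h.of_eq fun p q => by simp [Compat]

theorem primrec_cand : Primrec cand :=
  Primrec.unpair.comp (Primrec.fst.comp Primrec.unpair)

theorem primrec₂_side : Primrec₂ side :=
  Primrec.cond (Primrec.nat_bodd.comp Primrec.fst) (Primrec.snd.comp Primrec.snd)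
    (Primrec.fst.comp Primrec.snd)

variable {t : ℕ × ℕ → ℕ → Bool}

theorem computable₂_good (ht : Computable₂ t) : Computable₂ (good t) := by
  have hc : Primrec fun x : (ℕ × List (ℕ × ℕ)) × ℕ => cand x.2 := primrec_cand.comp Primrec.snd
  have hn : Primrec fun x : (ℕ × List (ℕ × ℕ)) × ℕ => x.1.1 := Primrec.fst.comp Primrec.fst
  have h₁ : Computable fun x : (ℕ × List (ℕ × ℕ)) × ℕ => t (cand x.2) x.2.unpair.2 :=
    ht.comp hc.to_comp (Primrec.snd.comp (Primrec.unpair.comp Primrec.snd)).to_comp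
  have h₂ : Primrec fun x : (ℕ × List (ℕ × ℕ)) × ℕ =>
      decide (side x.1.1 (cand x.2) = x.1.1.div2) :=
    (Primrec.eq.comp (primrec₂_side.comp hn hc) (Primrec.nat_div2.comp hn)).decide
  have h₃ : Primrec fun x : (ℕ × List (ℕ × ℕ)) × ℕ => decide (∀ q ∈ x.1.2, Compat q (cand x.2)) :=
    (primrecRel_compat.forall_mem_list.comp (Primrec.snd.comp Primrec.fst) hc).decide
  exact Primrec.and.to_comp.comp h₁ (Primrec.and.comp h₂ h₃).to_comp

theorem partrec_step (ht : Computable₂ t) : Partrec (step t) := by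
  have h : Partrec₂ fun (s : ℕ × List (ℕ × ℕ)) (m : ℕ) => Part.some (good t s m) :=
    (computable₂_good ht).partrec₂
  refine (Partrec.rfind h).map ?_
  exact (Primrec.list_cons.comp (primrec_cand.comp Primrec.snd)
    (Primrec.snd.comp Primrec.fst)).to_comp

theorem partrec_stage (ht : Computable₂ t) : Partrec (stage t) := by
  have h : Partrec₂ fun (_ : ℕ) (s : ℕ × List (ℕ × ℕ)) => step t s :=
    (partrec_step ht).comp Computable.snd
  exact Partrec.nat_rec Computable.id (Computable.const []).partrec h

variable {T : ℕ × ℕ → Prop}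

/-- A list of pairs satisfying `T` that is the graph of a finite partial injection. -/
def Valid (T : ℕ × ℕ → Prop) (L : List (ℕ × ℕ)) : Prop :=
  ∀ p ∈ L, T p ∧ ∀ q ∈ L, Compat q p

theorem exists_extension (hrow : ∀ x, {y | T (x, y)}.Infinite)
    (hcol : ∀ y, {x | T (x, y)}.Infinite) {L : List (ℕ × ℕ)} (hL : Valid T L) (n : ℕ) :
    ∃ p, T p ∧ side n p = n.div2 ∧ ∀ q ∈ L, Compat q p := by
  by_cases hn : ∃ p ∈ L, side n p = n.div2
  · obtain ⟨p, hp, hs⟩ := hn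
    exact ⟨p, (hL p hp).1, hs, (hL p hp).2⟩
  push Not at hn
  cases hb : n.bodd
  · obtain ⟨y, hy, hyL⟩ := (hrow n.div2).exists_notMem_finset (L.map Prod.snd).toFinset
    refine ⟨(n.div2, y), hy, by simp [side, hb], fun q hq => iff_of_false ?_ ?_⟩
    · simpa [side, hb] using hn q hq
    · rintro rfl
      exact hyL (List.mem_toFinset.2 (List.mem_map_of_mem hq))
  · obtain ⟨x, hx, hxL⟩ := (hcol n.div2).exists_notMem_finset (L.map Prod.fst).toFinset
    refine ⟨(x, n.div2), hx, by simp [side, hb], fun q hq => iff_of_false ?_ ?_⟩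
    · rintro rfl
      exact hxL (List.mem_toFinset.2 (List.mem_map_of_mem hq))
    · simpa [side, hb] using hn q hq

theorem step_dom (htT : ∀ p, T p ↔ ∃ k, t p k = true) {n : ℕ} {L : List (ℕ × ℕ)} {p : ℕ × ℕ}
    (hp : T p) (hs : side n p = n.div2) (hc : ∀ q ∈ L, Compat q p) : (step t (n, L)).Dom := by
  obtain ⟨k, hk⟩ := (htT p).1 hp
  refine Nat.rfind_dom.2 ⟨Nat.pair (Nat.pair p.1 p.2) k, ?_, fun _ => trivial⟩
  simp only [good, cand, Nat.unpair_pair, Prod.mk.eta, hk, hs, decide_true, Bool.true_and,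
    decide_eq_true hc, Part.mem_some_iff]

theorem of_mem_step (htT : ∀ p, T p ↔ ∃ k, t p k = true) {n : ℕ} {L L' : List (ℕ × ℕ)}
    (h : L' ∈ step t (n, L)) :
    ∃ p, L' = p :: L ∧ T p ∧ side n p = n.div2 ∧ ∀ q ∈ L, Compat q p := by
  obtain ⟨m, hm, rfl⟩ := (Part.mem_map_iff _).1 h
  have hg := Nat.rfind_spec hm
  simp only [Part.mem_some_iff, good, Bool.true_eq, Bool.and_eq_true, decide_eq_true_eq] at hg
  exact ⟨cand m, rfl, (htT _).2 ⟨_, hg.1⟩, hg.2⟩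

theorem Valid.cons {L : List (ℕ × ℕ)} (hL : Valid T L) {p : ℕ × ℕ} (hp : T p)
    (hc : ∀ q ∈ L, Compat q p) : Valid T (p :: L) := by
  intro q hq
  rcases List.mem_cons.1 hq with rfl | hqL
  · refine ⟨hp, fun r hr => ?_⟩
    rcases List.mem_cons.1 hr with rfl | hrL
    · simp [Compat]
    · exact hc r hrL
  · refine ⟨(hL q hqL).1, fun r hr => ?_⟩
    rcases List.mem_cons.1 hr with rfl | hrL
    · exact (hc q hqL).symm
    · exact (hL q hqL).2 r hrL

theorem exists_mem_stage (htT : ∀ p, T p ↔ ∃ k, t p k = true)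
    (hrow : ∀ x, {y | T (x, y)}.Infinite) (hcol : ∀ y, {x | T (x, y)}.Infinite) (n : ℕ) :
    ∃ L ∈ stage t n, Valid T L := by
  induction n with
  | zero => exact ⟨[], Part.mem_some _, fun p hp => by simp at hp⟩
  | succ n ih =>
    obtain ⟨L, hL, hv⟩ := ih
    obtain ⟨p, hp, hs, hc⟩ := exists_extension hrow hcol hv n
    obtain ⟨L', hL'⟩ := Part.dom_iff_mem.1 (step_dom htT hp hs hc)
    obtain ⟨q, rfl, hq, -, hqc⟩ := of_mem_step htT hL'
    exact ⟨q :: L, Part.mem_bind hL hL', hv.cons hq hqc⟩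

/-- There is a computable enumeration of pairwise compatible elements of `T` in which the `n`-th
pair meets the requirement of stage `n`. -/
theorem exists_computable_enumeration (hT : REPred T)
    (hrow : ∀ x, {y | T (x, y)}.Infinite) (hcol : ∀ y, {x | T (x, y)}.Infinite) :
    ∃ e : ℕ → ℕ × ℕ, Computable e ∧ (∀ n, T (e n)) ∧ (∀ n, side n (e n) = n.div2) ∧
      ∀ m n, Compat (e m) (e n) := by
  obtain ⟨t, ht, htT⟩ := hT.exists_computable_witness
  choose L hL hv using exists_mem_stage htT hrow hcol
  have hLc : Computable L := (partrec_stage ht).of_eq_tot hL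
  have hsucc : ∀ n, ∃ p, L (n + 1) = p :: L n ∧ T p ∧ side n p = n.div2 ∧
      ∀ q ∈ L n, Compat q p := by
    intro n
    obtain ⟨l, hl, hstep⟩ := Part.mem_bind_iff.1 (hL (n + 1))
    obtain rfl := Part.mem_unique hl (hL n)
    exact of_mem_step htT hstep
  choose e he heT hes _ using hsucc
  have hmono : Monotone fun n => {p | p ∈ L n} :=
    monotone_nat_of_le_succ fun n p hp => by
      rw [Set.mem_ofPred_eq, he]
      exact List.mem_cons_of_mem _ hp
  have hmem : ∀ {n k}, n + 1 ≤ k → e n ∈ L k := fun {n k} h =>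
    hmono h (by simp [he] : e n ∈ L (n + 1))
  refine ⟨e, ?_, heT, hes, fun m n => ?_⟩
  · exact (Primrec.list_headI.to_comp.comp (hLc.comp Computable.succ)).of_eq fun n => by
      simp [he]
  · exact (hv (max m n + 1) (e n) (hmem (by omega))).2 (e m) (hmem (by omega))

end BackAndForth

open BackAndForth in
/-- A recursively enumerable relation on `ℕ` all of whose rows and columns are infinite contains
the graph of a computable permutation. -/
theorem REPred.exists_computable_bijective {T : ℕ × ℕ → Prop} (hT : REPred T)
    (hrow : ∀ x, {y | T (x, y)}.Infinite) (hcol : ∀ y, {x | T (x, y)}.Infinite) :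
    ∃ h : ℕ → ℕ, Computable h ∧ Function.Bijective h ∧ ∀ x, T (x, h x) := by
  obtain ⟨e, hec, heT, hes, hcompat⟩ := exists_computable_enumeration hT hrow hcol
  have hfst : ∀ x, (e (2 * x)).1 = x := fun x => by
    simpa [side, Nat.div2_val] using hes (2 * x)
  have hsnd : ∀ y, (e (2 * y + 1)).2 = y := fun y => by
    have h : (2 * y + 1) / 2 = y := by omega
    simpa [side, Nat.div2_val, h] using hes (2 * y + 1)
  refine ⟨fun x => (e (2 * x)).2, ?_, ⟨fun x y hxy => ?_, fun y => ?_⟩, fun x => ?_⟩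
  · exact Computable.snd.comp (hec.comp Primrec.nat_double.to_comp)
  · simpa [hfst] using (hcompat (2 * x) (2 * y)).2 hxy
  · refine ⟨(e (2 * y + 1)).1, ?_⟩
    exact ((hcompat _ (2 * y + 1)).1 (hfst _)).trans (hsnd y)
  · have h := heT (2 * x)
    rwa [← Prod.mk.eta (p := e (2 * x)), hfst] at h

/-- If all `R`-classes and all `S`-classes are infinite, then `R ≃ S ↔ R ≃ₛ S`. -/
theorem stmt_2 (R S : ℕ → ℕ → Prop) (hR : Ceer R) (hS : Ceer S)
    (hRinf : ∀ x, {y | R y x}.Infinite) (hSinf : ∀ x, {y | S y x}.Infinite) :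
    CeerIso R S ↔ CeerStrongIso R S := by
  constructor
  · rintro ⟨f, hf, hfRS, hsurj⟩
    have hT : REPred fun p : ℕ × ℕ => S (f p.1) p.2 :=
      (Partrec.dom_re (hS.2.comp ((hf.comp Computable.fst).pair Computable.snd))).of_eq
        fun p => by simp [Part.assert]
    obtain ⟨h, hh, hbij, hfh⟩ := hT.exists_computable_bijective
      (fun x => (hSinf (f x)).mono fun y hy => hS.1.symm hy)
      (fun y => by
        obtain ⟨x, hx⟩ := hsurj y
        exact (hRinf x).mono fun z hz => hS.1.trans ((hfRS z x).1 hz) hx)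
    refine ⟨h, hh, hbij, fun x y => (hfRS x y).trans ⟨fun hxy => ?_, fun hxy => ?_⟩⟩
    · exact hS.1.trans (hS.1.symm (hfh x)) (hS.1.trans hxy (hfh y))
    · exact hS.1.trans (hfh x) (hS.1.trans hxy (hS.1.symm (hfh y)))
  · rintro ⟨f, hf, hbij, hfRS⟩
    refine ⟨f, hf, hfRS, fun z => ?_⟩
    obtain ⟨x, rfl⟩ := hbij.surjective z
    exact ⟨x, hS.1.refl _⟩
end

section
/- Let E be the word problem of a c.e. semigroup that is not periodic, i.e., E is a ceer that is a congruence for a computable binary operation f on ℕ which is associative modulo E, and there exists a ∈ ℕ such that for all m, n ≥ 1 with m ≠ n, the powers a^m and a^n are not E-equivalent. Then E admits an infinite c.e. transversal (namely {a^n : n ≥ 1}). Consequently, if R is a dark ceer then R is not bi-reducible with E; hence the class of non-periodic semigroups is not ≡-complete for the ceers. -/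
/-- A set of naturals is computably enumerable. -/
def CeSet (A : Set ℕ) : Prop :=
  Partrec fun n : ℕ => Part.assert (n ∈ A) fun _ => Part.some 0

/-- `E` is a congruence with respect to the binary operation `f` on ℕ. -/
def CeerCongruence (E : ℕ → ℕ → Prop) (f : ℕ → ℕ → ℕ) : Prop :=
  ∀ a a' b b', E a a' → E b b' → E (f a b) (f a' b')

/-- `R` is (computably) reducible to `S`. -/
def CeerReduces (R S : ℕ → ℕ → Prop) : Prop :=
  ∃ g : ℕ → ℕ, Computable g ∧ ∀ x y, R x y ↔ S (g x) (g y)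

/-- Powers with respect to `f`: `iterPow f a k` is the (k+1)-st power `a^(k+1)`. -/
def iterPow (f : ℕ → ℕ → ℕ) (a : ℕ) : ℕ → ℕ
  | 0 => a
  | k + 1 => f (iterPow f a k) a

/-- `W` is an infinite c.e. transversal for `E`. -/
def InfCeTransversal (W : Set ℕ) (E : ℕ → ℕ → Prop) : Prop :=
  W.Infinite ∧ CeSet W ∧ ∀ x ∈ W, ∀ y ∈ W, x ≠ y → ¬ E x y

/-- A ceer is dark if it has infinitely many classes but no infinite c.e. transversal. -/
def Dark (R : ℕ → ℕ → Prop) : Prop :=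
  Ceer R ∧ (Set.range fun x => {y | R x y}).Infinite ∧ ¬ ∃ W, InfCeTransversal W R

/-- The range of a total computable function is computably enumerable. -/
theorem CeSet.range {g : ℕ → ℕ} (hg : Computable g) : CeSet (Set.range g) := by
  have hdec : Computable₂ fun n k : ℕ => decide (g k = n) :=
    (Primrec.eq.decide.to_comp.comp (hg.comp Computable.snd) Computable.fst)
  have hfind : Partrec fun n : ℕ => Nat.rfind fun k => Part.some (decide (g k = n)) :=
    Partrec.rfind hdec.partrec₂
  refine (hfind.map (Computable.const 0).to₂).of_eq fun n => ?_
  ext m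
  simp only [Part.mem_map_iff, Part.mem_assert_iff, Part.mem_some_iff, Set.mem_range]
  constructor
  · rintro ⟨k, hk, rfl⟩
    have hgk := Nat.rfind_spec hk
    simp only [Part.mem_some_iff] at hgk
    exact ⟨⟨k, of_decide_eq_true hgk.symm⟩, rfl⟩
  · rintro ⟨⟨k, hk⟩, rfl⟩
    have hdom : (Nat.rfind fun k => Part.some (decide (g k = n))).Dom :=
      Nat.rfind_dom.2 ⟨k, by simp [hk], fun _ => trivial⟩
    exact ⟨_, Part.get_mem hdom, rfl⟩

/-- The iterated powers of a fixed element under a computable operation are computable. -/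
theorem computable_iterPow {f : ℕ → ℕ → ℕ} (hf : Computable₂ f) (a : ℕ) :
    Computable (iterPow f a) := by
  have hstep : Computable₂ fun (_ : ℕ) (p : ℕ × ℕ) => f p.2 a :=
    hf.comp (Computable.snd.comp Computable.snd) (Computable.const a)
  refine (Computable.nat_rec Computable.id (Computable.const a) hstep).of_eq fun n => ?_
  induction n with
  | zero => rfl
  | succ k ih => exact congrArg (f · a) ih

/-- A computable sequence of pairwise inequivalent elements enumerates an infinite c.e.
transversal. -/
theorem InfCeTransversal.range {E : ℕ → ℕ → Prop} {g : ℕ → ℕ} (hrefl : ∀ x, E x x)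
    (hg : Computable g) (hne : ∀ m n, m ≠ n → ¬ E (g m) (g n)) :
    InfCeTransversal (Set.range g) E := by
  refine ⟨Set.infinite_range_of_injective fun m n h => ?_, CeSet.range hg, ?_⟩
  · by_contra hmn
    exact hne m n hmn (h ▸ hrefl (g m))
  · rintro _ ⟨m, rfl⟩ _ ⟨n, rfl⟩ hmn
    exact hne m n fun h => hmn (congrArg g h)

/-- If `E` is the word problem of a non-periodic c.e. semigroup, witnessed by `a` all of
whose powers are pairwise `E`-inequivalent, then `{a^n : n ≥ 1}` is an infinite
c.e. transversal for `E`; hence no dark ceer is bi-reducible with `E`. -/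
theorem stmt_6 (E : ℕ → ℕ → Prop) (f : ℕ → ℕ → ℕ)
    (hE : Ceer E) (hf : Computable₂ f) (hcong : CeerCongruence E f)
    (hassoc : ∀ a b c, E (f (f a b) c) (f a (f b c)))
    (a : ℕ) (ha : ∀ m n, m ≠ n → ¬ E (iterPow f a m) (iterPow f a n)) :
    InfCeTransversal (Set.range (iterPow f a)) E ∧
    ∀ R : ℕ → ℕ → Prop, Dark R → ¬ (CeerReduces R E ∧ CeerReduces E R) := by
  have hpow := computable_iterPow hf a
  refine ⟨.range hE.1.refl hpow ha, ?_⟩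
  rintro R ⟨hR, -, hdark⟩ ⟨-, g, hg, hgE⟩
  exact hdark ⟨_, .range hR.1.refl (hg.comp hpow) fun m n hmn h => ha m n hmn ((hgE _ _).2 h)⟩
end

section
/- Suppose W : ℕ → ℕ → ℕ → Prop is a uniformly c.e. sequence of ceers, i.e., the predicate (i,x,y) ↦ W i x y is computably enumerable and for each i the relation E_i := W i is an equivalence relation on ℕ; suppose moreover that the set {i : E_i has only finitely many equivalence classes} is computably enumerable. Then there exists a ceer E with infinitely many equivalence classes such that for every i, either E_i is not reducible to E or E_i has only finitely many equivalence classes. In particular, for every i, E_i is not bi-reducible with E. -/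
/-- An equivalence relation is finite if it has finitely many equivalence classes. -/
def FinitelyManyClasses (E : ℕ → ℕ → Prop) : Prop :=
  (Set.range fun x => {y | E x y}).Finite

namespace CeerDiagonal

/-- Redirect the class with representative `a` to the representative `b`. -/
def merge (r : ℕ → ℕ) (a b n : ℕ) : ℕ := if r n = a then b else r n

/-- `r` selects from each class of its kernel a representative below all members. -/
def IsRep (r : ℕ → ℕ) : Prop := ∀ n, r (r n) = r n ∧ r n ≤ n

/-- The position of the class of `n` in the list of all classes of the kernel of `r`,
truncated at `j`. -/
def colour (r : ℕ → ℕ) (j n : ℕ) : ℕ := min j (Nat.count (fun m => r m = m) (r n))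

theorem IsRep.merge {r : ℕ → ℕ} (hr : IsRep r) {a b : ℕ} (hb : r b = b) (hba : b ≤ a) :
    IsRep (merge r a b) := by
  intro n
  have h1 := (hr n).1
  have h2 := (hr n).2
  unfold CeerDiagonal.merge
  split_ifs <;> grind

theorem merge_self (r : ℕ → ℕ) (a : ℕ) : merge r a a = r := by
  funext n
  unfold merge
  split_ifs with h
  · exact h.symm
  · rfl

theorem colour_merge {r : ℕ → ℕ} {a b j k : ℕ} (ha : r a = a)
    (hb : r b = b) (hba : b ≤ a) (hab : colour r k a = colour r k b) (hjk : j ≤ k) (n : ℕ) :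
    colour (merge r a b) j n = colour r j n := by
  rcases hba.eq_or_lt with rfl | hba
  · rw [merge_self]
  have hcount : ∀ m ≤ a, Nat.count (fun m => merge r a b m = m) m
      = Nat.count (fun m => r m = m) m := by
    intro m hm
    apply le_antisymm <;> refine Nat.count_mono_left fun i hi h => ?_ <;>
      unfold merge at * <;> grind
  have hlt : Nat.count (fun m => r m = m) b < Nat.count (fun m => r m = m) a :=
    Nat.count_strict_mono (p := fun m => r m = m) hb hba
  have hk : k ≤ Nat.count (fun m => r m = m) b := by
    unfold colour at hab
    rw [ha, hb] at hab
    omega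
  unfold colour
  by_cases hn : r n = a
  · have : merge r a b n = b := if_pos hn
    rw [this, hn, hcount b hba.le]
    omega
  · have : merge r a b n = r n := if_neg hn
    rw [this]
    rcases le_total (r n) a with h | h
    · rw [hcount _ h]
    · have h1 := Nat.count_monotone (fun m => r m = m) h
      have h2 := Nat.count_monotone (fun m => merge r a b m = m) h
      rw [hcount a le_rfl] at h2
      omega

theorem colour_eq_of_eq {r : ℕ → ℕ} {m n : ℕ} (h : r m = r n) (j : ℕ) :
    colour r j m = colour r j n := by
  unfold colour
  rw [h]

theorem colour_rep {r : ℕ → ℕ} (hr : IsRep r) (j n : ℕ) :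
    colour r j (r n) = colour r j n :=
  colour_eq_of_eq (hr n).1 j

/-- The representative of `n` after performing the redirections in `L`, last entry first. -/
def rep (L : List (ℕ × ℕ)) (n : ℕ) : ℕ :=
  L.foldr (fun q r => if r = q.1 then q.2 else r) n

section Construction

variable (φ : ℕ → ℕ → ℕ → Option ℕ) (V : ℕ → ℕ → ℕ → Bool)

/-- At stage `s` with collapses `L`, the requirement `j` may use the pair coded by `p`. -/
def Candidate (L : List (ℕ × ℕ)) (j s p : ℕ) : Prop :=
  V j s p = false ∧
    colour (rep L) j ((φ j s p.unpair.1).getD 0) = colour (rep L) j ((φ j s p.unpair.2).getD 0)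

/-- At stage `s`, which codes a requirement `j` and a pair `p`, the requirement `j` acts on `p`. -/
def Acts (L : List (ℕ × ℕ)) (s : ℕ) : Prop :=
  (∀ z < s.unpair.2.unpair.1 + 1, (φ s.unpair.1 s z).isSome = true) ∧
    Candidate φ V L s.unpair.1 s s.unpair.2.unpair.1 ∧
    ∀ q < s.unpair.2.unpair.1, ¬ Candidate φ V L s.unpair.1 s q

/-- The representative of the image of the first component of the pair treated at stage `s`. -/
def leftRep (L : List (ℕ × ℕ)) (s : ℕ) : ℕ :=
  rep L ((φ s.unpair.1 s s.unpair.2.unpair.1.unpair.1).getD 0)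

/-- The representative of the image of the second component of the pair treated at stage `s`. -/
def rightRep (L : List (ℕ × ℕ)) (s : ℕ) : ℕ :=
  rep L ((φ s.unpair.1 s s.unpair.2.unpair.1.unpair.2).getD 0)

open scoped Classical in
/-- One stage of the construction. -/
noncomputable def step (s : ℕ) (L : List (ℕ × ℕ)) : List (ℕ × ℕ) :=
  if Acts φ V L s then
    (max (leftRep φ L s) (rightRep φ L s), min (leftRep φ L s) (rightRep φ L s)) :: L
  else L

/-- The collapses made before stage `s`. -/
noncomputable def stage (s : ℕ) : List (ℕ × ℕ) := Nat.rec [] (step φ V) s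

/-- The representative function at stage `s`. -/
noncomputable def rho (s : ℕ) : ℕ → ℕ := rep (stage φ V s)

/-- The equivalence relation produced by the construction. -/
def Limit (x y : ℕ) : Prop := ∃ s, rho φ V s x = rho φ V s y

variable {φ V}

theorem rho_succ_of_not_acts {s : ℕ} (h : ¬ Acts φ V (stage φ V s) s) :
    rho φ V (s + 1) = rho φ V s := by
  have : stage φ V (s + 1) = stage φ V s := if_neg h
  rw [rho, this, rho]

theorem rho_succ_of_acts {s : ℕ} (h : Acts φ V (stage φ V s) s) :
    rho φ V (s + 1) = merge (rho φ V s)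
      (max (leftRep φ (stage φ V s) s) (rightRep φ (stage φ V s) s))
      (min (leftRep φ (stage φ V s) s) (rightRep φ (stage φ V s) s)) := by
  have : stage φ V (s + 1) = (max (leftRep φ (stage φ V s) s) (rightRep φ (stage φ V s) s),
    min (leftRep φ (stage φ V s) s) (rightRep φ (stage φ V s) s)) :: stage φ V s := if_pos h
  rw [rho, this]
  rfl

theorem isRep_rho (s : ℕ) : IsRep (rho φ V s) := by
  induction s with
  | zero => exact fun n => ⟨rfl, le_rfl⟩
  | succ s ih =>
    by_cases h : Acts φ V (stage φ V s) s
    · rw [rho_succ_of_acts h]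
      refine ih.merge ?_ min_le_max
      rcases min_choice (leftRep φ (stage φ V s) s) (rightRep φ (stage φ V s) s) with h | h <;>
        rw [h] <;> exact (ih _).1
    · rwa [rho_succ_of_not_acts h]

theorem rho_eq_mono {s t x y : ℕ} (hst : s ≤ t) (h : rho φ V s x = rho φ V s y) :
    rho φ V t x = rho φ V t y := by
  induction t, hst using Nat.le_induction with
  | base => exact h
  | succ t _ ih =>
    by_cases h : Acts φ V (stage φ V t) t
    · rw [rho_succ_of_acts h, merge, merge, ih]
    · rwa [rho_succ_of_not_acts h]

theorem limit_equivalence : Equivalence (Limit φ V) where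
  refl _ := ⟨0, rfl⟩
  symm := fun ⟨s, h⟩ => ⟨s, h.symm⟩
  trans := fun ⟨s, h⟩ ⟨t, h'⟩ => ⟨max s t,
    (rho_eq_mono (le_max_left s t) h).trans (rho_eq_mono (le_max_right s t) h')⟩

theorem colour_rho_succ {s j : ℕ} (hj : j ≤ s.unpair.1) (n : ℕ) :
    colour (rho φ V (s + 1)) j n = colour (rho φ V s) j n := by
  by_cases h : Acts φ V (stage φ V s) s
  · have hr : IsRep (rho φ V s) := isRep_rho s
    have hc : colour (rho φ V s) s.unpair.1 (leftRep φ (stage φ V s) s)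
        = colour (rho φ V s) s.unpair.1 (rightRep φ (stage φ V s) s) :=
      (colour_rep hr _ _).trans (h.2.1.2.trans (colour_rep hr _ _).symm)
    have h1 : rho φ V s (leftRep φ (stage φ V s) s) = leftRep φ (stage φ V s) s := (hr _).1
    have h2 : rho φ V s (rightRep φ (stage φ V s) s) = rightRep φ (stage φ V s) s := (hr _).1
    rw [rho_succ_of_acts h]
    rcases le_total (leftRep φ (stage φ V s) s) (rightRep φ (stage φ V s) s) with hle | hle
    · rw [max_eq_right hle, min_eq_left hle]
      exact colour_merge h2 h1 hle hc.symm hj n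
    · rw [max_eq_left hle, min_eq_right hle]
      exact colour_merge h1 h2 hle hc hj n
  · rw [rho_succ_of_not_acts h]

theorem rho_succ_eq_of_acts {s : ℕ} (h : Acts φ V (stage φ V s) s) :
    rho φ V (s + 1) ((φ s.unpair.1 s s.unpair.2.unpair.1.unpair.1).getD 0) =
      rho φ V (s + 1) ((φ s.unpair.1 s s.unpair.2.unpair.1.unpair.2).getD 0) := by
  rw [rho_succ_of_acts h]
  change (if leftRep φ (stage φ V s) s = _ then _ else leftRep φ (stage φ V s) s) =
    (if rightRep φ (stage φ V s) s = _ then _ else rightRep φ (stage φ V s) s)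
  grind

theorem rho_succ_of_eq {s : ℕ}
    (h : rho φ V s ((φ s.unpair.1 s s.unpair.2.unpair.1.unpair.1).getD 0) =
      rho φ V s ((φ s.unpair.1 s s.unpair.2.unpair.1.unpair.2).getD 0)) :
    rho φ V (s + 1) = rho φ V s := by
  by_cases ha : Acts φ V (stage φ V s) s
  · rw [rho_succ_of_acts ha]
    have : leftRep φ (stage φ V s) s = rightRep φ (stage φ V s) s := h
    rw [this, max_self, min_self, merge_self]
  · exact rho_succ_of_not_acts ha

/-- From stage `s₀` on, the requirements before `j` make no changes. -/
def QuietFrom (φ : ℕ → ℕ → ℕ → Option ℕ) (V : ℕ → ℕ → ℕ → Bool) (j s₀ : ℕ) : Prop :=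
  ∀ s ≥ s₀, s.unpair.1 < j → rho φ V (s + 1) = rho φ V s

theorem QuietFrom.colour_eq {j s₀ s : ℕ} (h : QuietFrom φ V j s₀) (hs : s₀ ≤ s) (n : ℕ) :
    colour (rho φ V s) j n = colour (rho φ V s₀) j n := by
  induction s, hs using Nat.le_induction with
  | base => rfl
  | succ s hs ih =>
    rcases lt_or_ge s.unpair.1 j with hj | hj
    · rw [h s hs hj, ih]
    · rw [colour_rho_succ hj, ih]

variable (hφ : ∀ j s t z v, s ≤ t → φ j s z = some v → φ j t z = some v)
  (hV : ∀ j s t p, s ≤ t → V j s p = true → V j t p = true)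

include hφ in
theorem exists_bound_forall_some {j : ℕ} {f : ℕ → ℕ} (hf : ∀ z, ∃ s, φ j s z = some (f z))
    (P : ℕ) : ∃ s₀, ∀ s ≥ s₀, ∀ z ≤ P, φ j s z = some (f z) := by
  choose g hg using hf
  refine ⟨(Finset.range (P + 1)).sup g, fun s hs z hz => hφ j (g z) s z _ ?_ (hg z)⟩
  exact (Finset.le_sup (f := g) (Finset.mem_range.2 (by omega))).trans hs

theorem unpair_bounds (p : ℕ) : p.unpair.1 ≤ p ∧ p.unpair.2 ≤ p :=
  ⟨Nat.unpair_left_le p, Nat.unpair_right_le p⟩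

include hφ in
/-- A pair whose images keep the same colour and which stays valid is eventually a candidate. -/
theorem QuietFrom.eventually_candidate {j s₀ : ℕ} (hq : QuietFrom φ V j s₀) {f : ℕ → ℕ}
    (hf : ∀ z, ∃ s, φ j s z = some (f z)) {p : ℕ} (hp : ∀ s, V j s p = false)
    (hc : colour (rho φ V s₀) j (f p.unpair.1) = colour (rho φ V s₀) j (f p.unpair.2)) :
    ∃ s₁, ∀ s ≥ s₁, Candidate φ V (stage φ V s) j s p := by
  obtain ⟨s₁, h₁⟩ := exists_bound_forall_some hφ hf p
  refine ⟨max s₀ s₁, fun s hs => ⟨hp s, ?_⟩⟩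
  have hb := unpair_bounds p
  rw [h₁ s (by omega) _ hb.1, h₁ s (by omega) _ hb.2]
  exact (hq.colour_eq (by omega) _).trans (hc.trans (hq.colour_eq (by omega) _).symm)

include hφ in
/-- A requirement using only finitely many pairs changes the relation only finitely often. -/
theorem eventually_quiet_of_bounded {j P s₁ : ℕ}
    (h : ∀ s ≥ s₁, s.unpair.1 = j → Acts φ V (stage φ V s) s → s.unpair.2.unpair.1 ≤ P) :
    ∃ s₀, ∀ s ≥ s₀, s.unpair.1 = j → rho φ V (s + 1) = rho φ V s := by
  have hp : ∀ p, ∃ t, ∀ s ≥ t, s.unpair.1 = j → s.unpair.2.unpair.1 = p →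
      rho φ V (s + 1) = rho φ V s := by
    intro p
    by_cases hact : ∃ t, t.unpair.1 = j ∧ t.unpair.2.unpair.1 = p ∧ Acts φ V (stage φ V t) t
    · obtain ⟨t, htj, htp, ht⟩ := hact
      refine ⟨t + 1, fun s hs hsj hsp => rho_succ_of_eq ?_⟩
      have heq := rho_eq_mono hs (rho_succ_eq_of_acts ht)
      have hb := unpair_bounds p
      obtain ⟨u, hu⟩ := Option.isSome_iff_exists.1 (ht.1 p.unpair.1 (by omega))
      obtain ⟨v, hv⟩ := Option.isSome_iff_exists.1 (ht.1 p.unpair.2 (by omega))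
      rw [htj] at hu hv heq
      have hts : t ≤ s := by omega
      rw [htp, hu, hv] at heq
      rw [hsj, hsp, hφ _ _ _ _ _ hts hu, hφ _ _ _ _ _ hts hv]
      exact heq
    · exact ⟨0, fun s _ hsj hsp => rho_succ_of_not_acts fun ha => hact ⟨s, hsj, hsp, ha⟩⟩
  choose t ht using hp
  refine ⟨max s₁ ((Finset.range (P + 1)).sup t), fun s hs hsj => ?_⟩
  by_cases ha : Acts φ V (stage φ V s) s
  · have hle := h s (by omega) hsj ha
    refine ht _ s ?_ hsj rfl
    exact (Finset.le_sup (f := t) (Finset.mem_range.2 (by omega))).trans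
      ((le_max_right _ _).trans hs)
  · exact rho_succ_of_not_acts ha

/-- Every colouring with finitely many colours makes the images under `φ j` of some forever valid
pair monochromatic. -/
def Separable (φ : ℕ → ℕ → ℕ → Option ℕ) (V : ℕ → ℕ → ℕ → Bool) (j : ℕ) : Prop :=
  ∃ f : ℕ → ℕ, (∀ z, ∃ s, φ j s z = some (f z)) ∧
    ∀ (c : ℕ → ℕ) (k : ℕ), (∀ n, c n ≤ k) →
      ∃ p, (∀ s, V j s p = false) ∧ c (f p.unpair.1) = c (f p.unpair.2)

variable (H : ∀ j, (∃ z, ∀ s, φ j s z = none) ∨ (∃ s, ∀ p, V j s p = true) ∨ Separable φ V j)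

include hφ hV H in
theorem exists_quietFrom (j : ℕ) : ∃ s₀, QuietFrom φ V j s₀ := by
  induction j with
  | zero => exact ⟨0, fun s _ h => absurd h (Nat.not_lt_zero _)⟩
  | succ j ih =>
    obtain ⟨s₀, h₀⟩ := ih
    have : ∃ P s₁, ∀ s ≥ s₁, s.unpair.1 = j → Acts φ V (stage φ V s) s →
        s.unpair.2.unpair.1 ≤ P := by
      rcases H j with ⟨z, hz⟩ | ⟨s₁, h₁⟩ | ⟨f, hf, hsep⟩
      · refine ⟨z, 0, fun s _ hsj ha => ?_⟩
        by_contra! hlt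
        have := ha.1 z (by omega)
        rw [hsj, hz] at this
        simp at this
      · refine ⟨0, s₁, fun s hs hsj ha => ?_⟩
        have h1 := ha.2.1.1
        rw [hsj, hV _ _ _ _ hs (h₁ _)] at h1
        simp at h1
      · obtain ⟨p, hp, hc⟩ := hsep (colour (rho φ V s₀) j) j fun n => min_le_left _ _
        obtain ⟨s₁, h₁⟩ := h₀.eventually_candidate hφ hf hp hc
        refine ⟨p, s₁, fun s hs hsj ha => ?_⟩
        by_contra! hlt
        refine ha.2.2 p hlt ?_
        rw [hsj]
        exact h₁ s hs
    obtain ⟨P, s₁, h₁⟩ := this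
    obtain ⟨t, ht⟩ := eventually_quiet_of_bounded hφ h₁
    refine ⟨max s₀ t, fun s hs hsj => ?_⟩
    rcases Nat.lt_succ_iff_lt_or_eq.1 hsj with h | h
    · exact h₀ s (by omega) h
    · exact ht s (by omega) h

include hφ hV H in
theorem exists_limit_of_separable {j : ℕ} (hj : Separable φ V j) :
    ∃ f : ℕ → ℕ, (∀ z, ∃ s, φ j s z = some (f z)) ∧
      ∃ p, (∀ s, V j s p = false) ∧ Limit φ V (f p.unpair.1) (f p.unpair.2) := by
  obtain ⟨s₀, h₀⟩ := exists_quietFrom hφ hV H j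
  obtain ⟨f, hf, hsep⟩ := hj
  refine ⟨f, hf, ?_⟩
  have hex := hsep (colour (rho φ V s₀) j) j fun n => min_le_left _ _
  classical
  obtain ⟨p, ⟨hp, hc⟩, hmin⟩ : ∃ p, ((∀ s, V j s p = false) ∧
      colour (rho φ V s₀) j (f p.unpair.1) = colour (rho φ V s₀) j (f p.unpair.2)) ∧
      ∀ q < p, ¬ ((∀ s, V j s q = false) ∧
        colour (rho φ V s₀) j (f q.unpair.1) = colour (rho φ V s₀) j (f q.unpair.2)) :=
    ⟨Nat.find hex, Nat.find_spec hex, fun q hq => Nat.find_min hex hq⟩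
  refine ⟨p, hp, ?_⟩
  obtain ⟨s₁, h₁⟩ := h₀.eventually_candidate hφ hf hp hc
  obtain ⟨s₂, h₂⟩ := exists_bound_forall_some hφ hf p
  have hlow : ∀ q, ∃ t, ∀ s ≥ t, q < p → s₀ ≤ s → s₂ ≤ s →
      ¬ Candidate φ V (stage φ V s) j s q := by
    intro q
    by_cases hq : ∀ s, V j s q = false
    · refine ⟨0, fun s _ hqp hs₀ hs₂ hcand => hmin q hqp ⟨hq, ?_⟩⟩
      have hb := unpair_bounds q
      have := hcand.2
      rw [h₂ s hs₂ _ (by omega), h₂ s hs₂ _ (by omega)] at this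
      change colour (rho φ V s) j _ = colour (rho φ V s) j _ at this
      rwa [h₀.colour_eq hs₀, h₀.colour_eq hs₀] at this
    · push Not at hq
      obtain ⟨t, ht⟩ := hq
      refine ⟨t, fun s hs _ _ _ hcand => ?_⟩
      have h1 := hcand.1
      rw [hV _ _ _ _ hs (by simpa using ht)] at h1
      simp at h1
  choose t ht using hlow
  set T := s₀ + s₁ + s₂ + (Finset.range p).sup t
  set s := Nat.pair j (Nat.pair p T) with hs
  have hTs : T ≤ s := (Nat.right_le_pair p T).trans (Nat.right_le_pair j _)
  have hsj : s.unpair.1 = j := by simp [hs]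
  have hsp : s.unpair.2.unpair.1 = p := by simp [hs]
  have hact : Acts φ V (stage φ V s) s := by
    unfold Acts
    rw [hsj, hsp]
    refine ⟨fun z hz => ?_, h₁ s (by omega), fun q hq => ht q s ?_ hq (by omega) (by omega)⟩
    · rw [h₂ s (by omega) z (by omega)]
      rfl
    · have := Finset.le_sup (f := t) (Finset.mem_range.2 hq)
      omega
  have := rho_succ_eq_of_acts hact
  have hb := unpair_bounds p
  rw [hsj, hsp, h₂ s (by omega) _ hb.1, h₂ s (by omega) _ hb.2] at this
  exact ⟨s + 1, this⟩

theorem exists_forall_rho_eq_self (s : ℕ) : ∃ B, ∀ n ≥ B, rho φ V s n = n := by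
  induction s with
  | zero => exact ⟨0, fun n _ => rfl⟩
  | succ s ih =>
    obtain ⟨B, hB⟩ := ih
    by_cases h : Acts φ V (stage φ V s) s
    · rw [rho_succ_of_acts h]
      generalize max (leftRep φ _ s) _ = a
      refine ⟨B + a + 1, fun n hn => ?_⟩
      rw [merge, if_neg] <;> rw [hB n (by omega)]
      omega
    · rw [rho_succ_of_not_acts h]
      exact ⟨B, hB⟩

include hφ hV H in
theorem not_finitelyManyClasses_limit : ¬ FinitelyManyClasses (Limit φ V) := by
  intro hfin
  obtain ⟨s₀, h₀⟩ := exists_quietFrom hφ hV H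
    (Set.ncard (Set.range fun x => {y | Limit φ V x y}) + 1)
  set k := Set.ncard (Set.range fun x => {y | Limit φ V x y}) with hk
  have hinf : (Set.ofPred fun m => rho φ V s₀ m = m).Infinite := by
    obtain ⟨B, hB⟩ := exists_forall_rho_eq_self (φ := φ) (V := V) s₀
    exact (Set.Ici_infinite B).mono fun n hn => hB n hn
  set g : ℕ → ℕ := Nat.nth fun m => rho φ V s₀ m = m with hg
  have hcol : ∀ i < k + 1, colour (rho φ V s₀) (k + 1) (g i) = i := by
    intro i hi
    have hroot : rho φ V s₀ (g i) = g i := Nat.nth_mem_of_infinite hinf i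
    rw [colour, hroot, hg, Nat.count_nth_of_infinite hinf]
    omega
  have hinj : Function.Injective
      fun i : Fin (k + 1) => ({y | Limit φ V (g i) y} : Set ℕ) := by
    intro i i' h
    have hmem : g i' ∈ {y | Limit φ V (g i) y} := by
      rw [show {y | Limit φ V (g i) y} = {y | Limit φ V (g i') y} from h]
      exact limit_equivalence.refl _
    obtain ⟨s, hs⟩ := hmem
    have := colour_eq_of_eq (rho_eq_mono (le_max_left s s₀) hs) (k + 1)
    rw [h₀.colour_eq (le_max_right _ _), h₀.colour_eq (le_max_right _ _), hcol _ i.2,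
      hcol _ i'.2] at this
    exact Fin.ext this
  have hle : Set.ncard (Set.range fun i : Fin (k + 1) => ({y | Limit φ V (g i) y} : Set ℕ)) ≤ k :=
    Set.ncard_le_ncard (by rintro _ ⟨i, rfl⟩; exact ⟨g i, rfl⟩) hfin
  rw [← Set.image_univ, Set.ncard_image_of_injective _ hinj, Set.ncard_univ, Nat.card_fin] at hle
  omega

end Construction

section Computability

variable {φ : ℕ → ℕ → ℕ → Option ℕ} {V : ℕ → ℕ → ℕ → Bool}

theorem primrec_rep : Primrec₂ rep :=
  Primrec.list_foldr (h := fun (_ : List (ℕ × ℕ) × ℕ) (q : (ℕ × ℕ) × ℕ) =>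
      if q.2 = q.1.1 then q.1.2 else q.2) Primrec.fst Primrec.snd
    (Primrec.ite (Primrec.eq.comp (Primrec.snd.comp Primrec.snd)
        (Primrec.fst.comp (Primrec.fst.comp Primrec.snd)))
      (Primrec.snd.comp (Primrec.fst.comp Primrec.snd)) (Primrec.snd.comp Primrec.snd)).to₂

theorem primrec_count_rep :
    Primrec₂ fun (L : List (ℕ × ℕ)) n => Nat.count (fun m => rep L m = m) n := by
  have hstep : Primrec₂ fun (q : List (ℕ × ℕ) × ℕ) (w : ℕ × ℕ) =>
      w.2 + if rep q.1 w.1 = w.1 then 1 else 0 :=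
    (Primrec.nat_add.comp (Primrec.snd.comp Primrec.snd)
      (Primrec.ite (Primrec.eq.comp (primrec_rep.comp (Primrec.fst.comp Primrec.fst)
        (Primrec.fst.comp Primrec.snd)) (Primrec.fst.comp Primrec.snd))
        (Primrec.const 1) (Primrec.const 0))).to₂
  refine (Primrec.nat_rec' Primrec.snd (Primrec.const 0) hstep).of_eq fun q => ?_
  obtain ⟨L, n⟩ := q
  change (Nat.rec 0 (fun m c => c + if rep L m = m then 1 else 0) n : ℕ)
    = Nat.count (fun m => rep L m = m) n
  induction n with
  | zero => simp
  | succ n ih => rw [Nat.count_succ, ← ih]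

theorem primrec_colour :
    Primrec fun q : List (ℕ × ℕ) × ℕ × ℕ => colour (rep q.1) q.2.1 q.2.2 :=
  Primrec.nat_min.comp (Primrec.fst.comp Primrec.snd)
    (primrec_count_rep.comp Primrec.fst
      (primrec_rep.comp Primrec.fst (Primrec.snd.comp Primrec.snd)))

theorem primrecPred_forall_lt {β : Type*} [Primcodable β] {R : ℕ → β → Prop}
    (hR : PrimrecRel R) {f : β → ℕ} (hf : Primrec f) :
    PrimrecPred fun b => ∀ x < f b, R x b := by
  have h : PrimrecPred fun b => ∀ x ∈ List.range (f b), R x b :=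
    PrimrecRel.comp (R := fun (L : List ℕ) b => ∀ x ∈ L, R x b) hR.forall_mem_list
      (Primrec.list_range.comp hf) Primrec.id
  exact h.of_eq fun b => by simp

variable (hφ : Primrec fun q : ℕ × ℕ × ℕ => φ q.1 q.2.1 q.2.2)
  (hV : Primrec fun q : ℕ × ℕ × ℕ => V q.1 q.2.1 q.2.2)

include hφ in
theorem primrec_approx {α : Type*} [Primcodable α] {f g h : α → ℕ} (hf : Primrec f)
    (hg : Primrec g) (hh : Primrec h) : Primrec fun a => φ (f a) (g a) (h a) :=
  hφ.comp (hf.pair (hg.pair hh))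

include hφ hV in
theorem primrecPred_candidate {α : Type*} [Primcodable α] {L : α → List (ℕ × ℕ)} {f g h : α → ℕ}
    (hL : Primrec L) (hf : Primrec f) (hg : Primrec g) (hh : Primrec h) :
    PrimrecPred fun a => Candidate φ V (L a) (f a) (g a) (h a) := by
  have himage : ∀ {u : α → ℕ}, Primrec u →
      Primrec fun a => colour (rep (L a)) (f a) ((φ (f a) (g a) (u a)).getD 0) := fun hu =>
    primrec_colour.comp (hL.pair (hf.pair (Primrec.option_getD.comp
      (primrec_approx hφ hf hg hu) (Primrec.const 0))))
  exact (Primrec.eq.comp (hV.comp (hf.pair (hg.pair hh))) (Primrec.const false)).and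
    (Primrec.eq.comp (himage (Primrec.fst.comp (Primrec.unpair.comp hh)))
      (himage (Primrec.snd.comp (Primrec.unpair.comp hh))))

include hφ hV in
theorem primrecPred_acts : PrimrecPred fun q : ℕ × List (ℕ × ℕ) => Acts φ V q.2 q.1 := by
  have hj : Primrec fun s : ℕ => s.unpair.1 := Primrec.fst.comp Primrec.unpair
  have hp : Primrec fun s : ℕ => s.unpair.2.unpair.1 :=
    hj.comp (Primrec.snd.comp Primrec.unpair)
  have h1 : PrimrecRel fun (z : ℕ) (q : ℕ × List (ℕ × ℕ)) =>
      (φ q.1.unpair.1 q.1 z).isSome = true :=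
    Primrec.eq.comp (Primrec.option_isSome.comp (primrec_approx hφ
      (hj.comp (Primrec.fst.comp Primrec.snd)) (Primrec.fst.comp Primrec.snd) Primrec.fst))
      (Primrec.const true)
  have h2 : PrimrecRel fun (p : ℕ) (q : ℕ × List (ℕ × ℕ)) =>
      ¬ Candidate φ V q.2 q.1.unpair.1 q.1 p :=
    (primrecPred_candidate hφ hV (Primrec.snd.comp Primrec.snd)
      (hj.comp (Primrec.fst.comp Primrec.snd)) (Primrec.fst.comp Primrec.snd) Primrec.fst).not
  have h3 : PrimrecPred fun q : ℕ × List (ℕ × ℕ) =>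
      ∀ z < q.1.unpair.2.unpair.1 + 1, (φ q.1.unpair.1 q.1 z).isSome = true :=
    primrecPred_forall_lt h1 (Primrec.succ.comp (hp.comp Primrec.fst))
  exact h3.and
    ((primrecPred_candidate hφ hV Primrec.snd (hj.comp Primrec.fst) Primrec.fst
      (hp.comp Primrec.fst)).and (primrecPred_forall_lt h2 (hp.comp Primrec.fst)))

include hφ hV in
theorem primrec_stage : Primrec (stage φ V) := by
  have hj : Primrec fun s : ℕ => s.unpair.1 := Primrec.fst.comp Primrec.unpair
  have hp : Primrec fun s : ℕ => s.unpair.2.unpair.1.unpair :=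
    Primrec.unpair.comp (hj.comp (Primrec.snd.comp Primrec.unpair))
  have himage : ∀ {u : ℕ → ℕ}, Primrec u → Primrec fun q : ℕ × List (ℕ × ℕ) =>
      rep q.2 ((φ q.1.unpair.1 q.1 (u q.1)).getD 0) := fun hu =>
    primrec_rep.comp Primrec.snd (Primrec.option_getD.comp
      (primrec_approx hφ (hj.comp Primrec.fst) Primrec.fst (hu.comp Primrec.fst))
      (Primrec.const 0))
  have hl := himage (Primrec.fst.comp hp)
  have hr := himage (Primrec.snd.comp hp)
  classical
  refine Primrec.nat_rec₁ (f := step φ V) [] (Primrec.of_eq (Primrec.ite (primrecPred_acts hφ hV)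
    (Primrec.list_cons.comp ((Primrec.nat_max.comp hl hr).pair (Primrec.nat_min.comp hl hr))
      Primrec.snd) Primrec.snd) fun q => ?_)
  simp only [step, leftRep, rightRep]

theorem partrec_assert_exists {α : Type*} [Primcodable α] {R : α → ℕ → Prop}
    (hR : PrimrecRel R) :
    Partrec fun a => Part.assert (∃ s, R a s) fun _ => Part.some 0 := by
  classical
  have hR := PrimrecPred.decide hR
  have h : Partrec fun a => (Nat.rfind fun s => Part.some (decide (R a s))).map fun _ => 0 :=
    (Partrec.rfind (Computable.partrec hR.to_comp).to₂).map (Computable.const 0).to₂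
  refine h.of_eq fun a => Part.ext' ?_ ?_
  · change (Nat.rfind _).Dom ↔ ∃ _ : ∃ s, R a s, True
    refine Nat.rfind_dom.trans ?_
    simp
  · intro _ _
    rfl

include hφ hV in
theorem ceRel_limit : CeRel (Limit φ V) :=
  partrec_assert_exists (R := fun (q : ℕ × ℕ) s => rho φ V s q.1 = rho φ V s q.2)
    (Primrec.eq.comp
      (primrec_rep.comp ((primrec_stage hφ hV).comp Primrec.snd)
        (Primrec.fst.comp Primrec.fst))
      (primrec_rep.comp ((primrec_stage hφ hV).comp Primrec.snd)
        (Primrec.snd.comp Primrec.fst)))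

end Computability

theorem exists_code_evaln_iff {A : ℕ → Prop}
    (hA : Partrec fun n : ℕ => Part.assert (A n) fun _ => Part.some 0) :
    ∃ c : Nat.Partrec.Code, ∀ n, A n ↔ ∃ s, (c.evaln s n).isSome = true := by
  obtain ⟨c, hc⟩ := Nat.Partrec.Code.exists_code.1 (Partrec.nat_iff.1 hA)
  refine ⟨c, fun n => ?_⟩
  have h : A n ↔ 0 ∈ c.eval n := by simp [hc]
  constructor
  · intro hn
    obtain ⟨s, hs⟩ := Nat.Partrec.Code.evaln_complete.1 (h.1 hn)
    exact ⟨s, Option.isSome_iff_exists.2 ⟨0, hs⟩⟩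
  · rintro ⟨s, hs⟩
    obtain ⟨v, hv⟩ := Option.isSome_iff_exists.1 hs
    have := Nat.Partrec.Code.evaln_sound hv
    rw [hc] at this
    simp only [Part.mem_assert_iff] at this
    exact this.1

theorem evaln_isSome_mono {c : Nat.Partrec.Code} {s t n : ℕ} (hst : s ≤ t)
    (h : (c.evaln s n).isSome = true) : (c.evaln t n).isSome = true := by
  obtain ⟨v, hv⟩ := Option.isSome_iff_exists.1 h
  exact Option.isSome_iff_exists.2 ⟨v, Nat.Partrec.Code.evaln_mono hst hv⟩

theorem finitelyManyClasses_of_invariant {R : ℕ → ℕ → Prop} (hR : Equivalence R) {c : ℕ → ℕ}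
    {k : ℕ} (hc : ∀ n, c n ≤ k) (h : ∀ x y, c x = c y → R x y) : FinitelyManyClasses R := by
  have hcfin : (Set.range c).Finite :=
    (Set.finite_Iic k).subset (by rintro _ ⟨n, rfl⟩; exact hc n)
  refine (hcfin.image fun i => {y | ∃ x, c x = i ∧ R x y}).subset ?_
  rintro _ ⟨x, rfl⟩
  refine ⟨c x, ⟨x, rfl⟩, Set.ext fun y => ⟨?_, fun hy => ⟨x, rfl, hy⟩⟩⟩
  rintro ⟨x', hx', hy⟩
  exact hR.trans (hR.symm (h x' x hx')) hy

theorem FinitelyManyClasses.of_reduces {R S : ℕ → ℕ → Prop} (h : CeerReduces R S) (hfin : FinitelyManyClasses S) :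
    FinitelyManyClasses R := by
  obtain ⟨g, -, hg⟩ := h
  refine (hfin.image fun C => {y | g y ∈ C}).subset ?_
  rintro _ ⟨x, rfl⟩
  exact ⟨_, ⟨g x, rfl⟩, Set.ext fun y => (hg x y).symm⟩

open Nat.Partrec (Code) in
theorem exists_ceer (W : ℕ → ℕ → ℕ → Prop)
    (hW : Partrec fun p : ℕ × ℕ × ℕ =>
      Part.assert (W p.1 p.2.1 p.2.2) fun _ => Part.some 0)
    (heq : ∀ i, Equivalence (W i))
    (hfin : CeSet {i | FinitelyManyClasses (W i)}) :
    ∃ E : ℕ → ℕ → Prop, Ceer E ∧ ¬ FinitelyManyClasses E ∧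
      ∀ i, CeerReduces (W i) E → FinitelyManyClasses (W i) := by
  obtain ⟨cF, hcF⟩ := exists_code_evaln_iff hfin
  have hW' : Partrec fun n : ℕ =>
      Part.assert (W n.unpair.1 n.unpair.2.unpair.1 n.unpair.2.unpair.2) fun _ => Part.some 0 := by
    have hpair : Computable fun n : ℕ =>
        (n.unpair.1, n.unpair.2.unpair.1, n.unpair.2.unpair.2) :=
      ((Primrec.fst.comp Primrec.unpair).pair
        (Primrec.unpair.comp (Primrec.snd.comp Primrec.unpair))).to_comp
    exact hW.comp hpair
  obtain ⟨cW, hcW⟩ := exists_code_evaln_iff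
    (A := fun n => W n.unpair.1 n.unpair.2.unpair.1 n.unpair.2.unpair.2) hW'
  set φ : ℕ → ℕ → ℕ → Option ℕ := fun j s z => (Denumerable.ofNat Code j.unpair.2).evaln s z
    with hφdef
  set V : ℕ → ℕ → ℕ → Bool := fun j s p =>
    (cW.evaln s (Nat.pair j.unpair.1 p)).isSome || (cF.evaln s j.unpair.1).isSome with hVdef
  have hφ : ∀ j s t z v, s ≤ t → φ j s z = some v → φ j t z = some v :=
    fun j s t z v hst h => Code.evaln_mono hst h
  have hV : ∀ j s t p, s ≤ t → V j s p = true → V j t p = true := by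
    intro j s t p hst h
    simp only [hVdef, Bool.or_eq_true] at h ⊢
    exact h.imp (evaln_isSome_mono hst) (evaln_isSome_mono hst)
  have hfst : Primrec fun q : ℕ × ℕ × ℕ => q.1.unpair :=
    Primrec.unpair.comp Primrec.fst
  have hs : Primrec fun q : ℕ × ℕ × ℕ => q.2.1 := Primrec.fst.comp Primrec.snd
  have hz : Primrec fun q : ℕ × ℕ × ℕ => q.2.2 := Primrec.snd.comp Primrec.snd
  have hφp : Primrec fun q : ℕ × ℕ × ℕ => φ q.1 q.2.1 q.2.2 :=
    Code.primrec_evaln.comp ((hs.pair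
      ((Primrec.ofNat Code).comp (Primrec.snd.comp hfst))).pair hz)
  have hVp : Primrec fun q : ℕ × ℕ × ℕ => V q.1 q.2.1 q.2.2 :=
    Primrec.or.comp
      (Primrec.option_isSome.comp (Code.primrec_evaln.comp ((hs.pair (Primrec.const cW)).pair
        (Primrec₂.natPair.comp (Primrec.fst.comp hfst) hz))))
      (Primrec.option_isSome.comp (Code.primrec_evaln.comp ((hs.pair (Primrec.const cF)).pair
        (Primrec.fst.comp hfst))))
  have hVfalse : ∀ j, ¬ FinitelyManyClasses (W j.unpair.1) → ∀ p,
      ((∀ s, V j s p = false) ↔ ¬ W j.unpair.1 p.unpair.1 p.unpair.2) := by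
    intro j hj p
    have h1 : ¬ ∃ s, (cF.evaln s j.unpair.1).isSome = true := fun h => hj ((hcF _).2 h)
    have h2 := hcW (Nat.pair j.unpair.1 p)
    simp only [Nat.unpair_pair] at h2
    push Not at h1
    rw [h2]
    simp [hVdef, h1]
  have H : ∀ j, (∃ z, ∀ s, φ j s z = none) ∨ (∃ s, ∀ p, V j s p = true) ∨
      Separable φ V j := by
    intro j
    by_cases hj : FinitelyManyClasses (W j.unpair.1)
    · obtain ⟨s, hs⟩ := (hcF _).1 hj
      exact Or.inr (Or.inl ⟨s, fun p => by simp [hVdef, hs]⟩)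
    by_cases htot : ∃ z, ∀ s, φ j s z = none
    · exact Or.inl htot
    refine Or.inr (Or.inr ?_)
    have hex : ∀ z, ∃ v s, φ j s z = some v := by
      intro z
      by_contra! h
      exact htot ⟨z, fun s => Option.eq_none_iff_forall_ne_some.2 fun v => h v s⟩
    choose f hf using hex
    refine ⟨f, hf, fun c k hc => ?_⟩
    by_contra! hno
    refine hj (finitelyManyClasses_of_invariant (heq _) (c := fun x => c (f x))
      (fun n => hc _) fun x y hxy => ?_)
    by_contra hnW
    refine hno (Nat.pair x y) ((hVfalse j hj _).2 ?_) ?_ <;> simpa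
  refine ⟨Limit φ V, ⟨limit_equivalence, ceRel_limit hφp hVp⟩,
    not_finitelyManyClasses_limit hφ hV H, fun i hred => ?_⟩
  by_contra hi
  obtain ⟨g, hg, hgred⟩ := hred
  obtain ⟨e, he⟩ := Code.exists_code.1 (Partrec.nat_iff.1 hg)
  have hval : ∀ s z v, φ (Nat.pair i (Encodable.encode e)) s z = some v → v = g z := by
    intro s z v h
    simp only [hφdef, Nat.unpair_pair, Denumerable.ofNat_encode] at h
    have := Code.evaln_sound h
    rw [he] at this
    simpa using this
  have hsep : Separable φ V (Nat.pair i (Encodable.encode e)) := by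
    rcases H (Nat.pair i (Encodable.encode e)) with ⟨z, hz⟩ | ⟨s, hs⟩ | h
    · have : g z ∈ e.eval z := by simp [he]
      obtain ⟨s, hs⟩ := Code.evaln_complete.1 this
      have := hz s
      simp only [hφdef, Nat.unpair_pair, Denumerable.ofNat_encode] at this
      rw [this] at hs
      simp at hs
    · have hW1 : ∀ p : ℕ, W i p.unpair.1 p.unpair.2 := by
        intro p
        have := hVfalse (Nat.pair i (Encodable.encode e)) (by simpa using hi) p
        simp only [Nat.unpair_pair] at this
        by_contra hn
        have := this.2 hn s
        rw [hs] at this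
        simp at this
      refine absurd (finitelyManyClasses_of_invariant (heq i) (c := fun _ => 0) (k := 0)
        (fun _ => le_rfl) fun x y _ => ?_) hi
      simpa using hW1 (Nat.pair x y)
    · exact h
  obtain ⟨f, hf, p, hp, hlim⟩ := exists_limit_of_separable hφ hV H hsep
  have hfg : ∀ z, f z = g z := fun z => (hf z).elim fun s hs => hval s z _ hs
  rw [hfg, hfg, ← hgred] at hlim
  exact (hVfalse _ (by simpa using hi) p).1 hp (by simpa using hlim)

end CeerDiagonal

/-- Given a uniformly c.e. sequence of ceers `W i` such that
`{i : W i has finitely many classes}` is c.e., there is an infinite ceer `E` such that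
for every `i`, either `W i` is not reducible to `E` or `W i` is finite; in particular
no `W i` is bi-reducible with `E`. -/
theorem stmt_10 (W : ℕ → ℕ → ℕ → Prop)
    (hW : Partrec fun p : ℕ × ℕ × ℕ =>
      Part.assert (W p.1 p.2.1 p.2.2) fun _ => Part.some 0)
    (heq : ∀ i, Equivalence (W i))
    (hfin : CeSet {i | FinitelyManyClasses (W i)}) :
    ∃ E : ℕ → ℕ → Prop, Ceer E ∧ ¬ FinitelyManyClasses E ∧
      (∀ i, ¬ CeerReduces (W i) E ∨ FinitelyManyClasses (W i)) ∧
      (∀ i, ¬ (CeerReduces (W i) E ∧ CeerReduces E (W i))) := by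
  obtain ⟨E, hE, hinf, h⟩ := CeerDiagonal.exists_ceer W hW heq hfin
  refine ⟨E, hE, hinf, fun i => ?_, fun i hi => ?_⟩
  · exact or_iff_not_imp_left.2 fun hi => h i (not_not.1 hi)
  · exact hinf (CeerDiagonal.FinitelyManyClasses.of_reduces hi.2 (h i hi.1))
end

section
/- No class of finitely generated semigroups is ≡-complete for the ceers: there exists a ceer E with infinitely many equivalence classes such that for every c.e. semigroup with finitely generated quotient — that is, for every computable binary operation f on ℕ and every ceer E' such that E' is a congruence with respect to f, f is associative modulo E', and there is a finite set G ⊆ ℕ with every x ∈ ℕ being E'-equivalent to some element of the subsemigroup of (ℕ, f) generated by G (the smallest subset of ℕ containing G and closed under f) — E is not bi-reducible with E'. -/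
/-- The subsemigroup of `(ℕ, f)` generated by `G`: the smallest subset of ℕ
containing `G` and closed under `f`. -/
def genClosure (f : ℕ → ℕ → ℕ) (G : Set ℕ) : Set ℕ :=
  ⋂₀ {S : Set ℕ | G ⊆ S ∧ ∀ a ∈ S, ∀ b ∈ S, f a b ∈ S}

open Nat.Partrec (Code)

/-- An injective enumeration of a set whose even members are the doubles of the halting programs:
`⟨e, k⟩` is sent to `2 * e` when program `e` needs exactly `k + 1` steps on input `0`, and to an
odd number otherwise. -/
def haltingEnum (s : ℕ) : ℕ :=
  bif (Code.evaln (s.unpair.2 + 1) (Denumerable.ofNat Code s.unpair.1) 0).isSome &&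
      !(Code.evaln s.unpair.2 (Denumerable.ofNat Code s.unpair.1) 0).isSome
  then 2 * s.unpair.1 else 2 * s + 1

theorem primrec_haltingEnum : Primrec haltingEnum := by
  have hc : Primrec fun s : ℕ => Denumerable.ofNat Code s.unpair.1 :=
    (Primrec.ofNat Code).comp (Primrec.fst.comp Primrec.unpair)
  have hk : Primrec fun s : ℕ => s.unpair.2 := Primrec.snd.comp Primrec.unpair
  have h1 : Primrec fun s : ℕ =>
      (Code.evaln s.unpair.2 (Denumerable.ofNat Code s.unpair.1) 0).isSome :=
    Primrec.option_isSome.comp (Code.primrec_evaln.comp ((hk.pair hc).pair (Primrec.const 0)))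
  have h2 : Primrec fun s : ℕ =>
      (Code.evaln (s.unpair.2 + 1) (Denumerable.ofNat Code s.unpair.1) 0).isSome :=
    Primrec.option_isSome.comp
      (Code.primrec_evaln.comp (((Primrec.succ.comp hk).pair hc).pair (Primrec.const 0)))
  exact Primrec.cond (Primrec.and.comp h2 (Primrec.not.comp h1))
    (Primrec.nat_mul.comp (Primrec.const 2) (Primrec.fst.comp Primrec.unpair))
    (Primrec.succ.comp (Primrec.nat_mul.comp (Primrec.const 2) Primrec.id))

theorem evaln_isSome_mono {c : Code} {n k l : ℕ} (h : k ≤ l)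
    (hk : (Code.evaln k c n).isSome) : (Code.evaln l c n).isSome := by
  obtain ⟨x, hx⟩ := Option.isSome_iff_exists.1 hk
  exact Option.isSome_iff_exists.2 ⟨x, Code.evaln_mono h hx⟩

theorem haltingEnum_eq_two_mul {s e : ℕ} (h : haltingEnum s = 2 * e) :
    s.unpair.1 = e ∧
      (Code.evaln (s.unpair.2 + 1) (Denumerable.ofNat Code e) 0).isSome ∧
      ¬ (Code.evaln s.unpair.2 (Denumerable.ofNat Code e) 0).isSome := by
  unfold haltingEnum at h
  rw [Bool.cond_eq_ite] at h
  split_ifs at h with hs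
  · obtain rfl : s.unpair.1 = e := by omega
    simpa using hs
  · omega

theorem haltingEnum_injective : Function.Injective haltingEnum := by
  intro s t hst
  rcases Nat.even_or_odd' (haltingEnum s) with ⟨e, he | he⟩
  · obtain ⟨hs, hs1, hs0⟩ := haltingEnum_eq_two_mul he
    obtain ⟨ht, ht1, ht0⟩ := haltingEnum_eq_two_mul (hst.symm.trans he)
    have h1 : s.unpair.2 = t.unpair.2 := by
      rcases lt_trichotomy s.unpair.2 t.unpair.2 with h | h | h
      · exact absurd (evaln_isSome_mono h hs1) ht0
      · exact h
      · exact absurd (evaln_isSome_mono h ht1) hs0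
    rw [← Nat.pair_unpair s, ← Nat.pair_unpair t, hs, ht, h1]
  · have key : ∀ u, haltingEnum u = 2 * e + 1 → u = e := by
      intro u hu
      unfold haltingEnum at hu
      rw [Bool.cond_eq_ite] at hu
      split_ifs at hu <;> omega
    rw [key s he, key t (hst.symm.trans he)]

theorem exists_haltingEnum_eq {e : ℕ} (h : (Code.eval (Denumerable.ofNat Code e) 0).Dom) :
    ∃ s, haltingEnum s = 2 * e := by
  classical
  obtain ⟨x, hx⟩ := Part.dom_iff_mem.1 h
  obtain ⟨k, hk⟩ := Code.evaln_complete.1 hx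
  have hex : ∃ k, (Code.evaln k (Denumerable.ofNat Code e) 0).isSome :=
    ⟨k, Option.isSome_iff_exists.2 ⟨x, hk⟩⟩
  obtain ⟨j, hj⟩ : ∃ j, Nat.find hex = j + 1 := by
    refine Nat.exists_eq_succ_of_ne_zero fun h0 => ?_
    have := Nat.find_spec hex
    rw [h0] at this
    simp [Code.evaln] at this
  have h1 := Nat.find_spec hex
  have h0 := Nat.find_min hex (m := j) (by omega)
  rw [hj] at h1
  refine ⟨Nat.pair e j, ?_⟩
  simp only [Bool.not_eq_true] at h0
  simp [haltingEnum, h0, h1]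

/-- The deficiency set of `haltingEnum`, a hypersimple set. -/
def Deficient (s : ℕ) : Prop := ∃ t, s < t ∧ haltingEnum t < haltingEnum s

theorem infinite_not_deficient : {s | ¬ Deficient s}.Infinite := by
  classical
  refine Set.infinite_of_not_bddAbove ?_
  rintro ⟨N, hN⟩
  have hex : ∃ v, ∃ s, N < s ∧ haltingEnum s = v := ⟨_, N + 1, by omega, rfl⟩
  obtain ⟨s, hs, hv⟩ := Nat.find_spec hex
  have : s ≤ N := hN fun ⟨t, hst, ht⟩ =>
    Nat.find_min hex (hv ▸ ht) ⟨t, by omega, rfl⟩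
  omega

/-- No computable function bounds, uniformly in `x`, a non-deficient stage whose value
exceeds `x`. -/
theorem not_exists_computable_bound (F : ℕ → ℕ) (hF : Computable F) :
    ¬ ∀ x, ∃ s < F x, ¬ Deficient s ∧ x < haltingEnum s := by
  intro h
  apply ComputablePred.halting_problem 0
  have hiff : ∀ c : Code, (Code.eval c 0).Dom ↔
      (Code.evaln (F (2 * Encodable.encode c)) c 0).isSome = true := by
    intro c
    constructor
    · intro hc
      obtain ⟨t, ht⟩ := exists_haltingEnum_eq (e := Encodable.encode c) (by simpa using hc)
      obtain ⟨s, hsF, hs, hlt⟩ := h (2 * Encodable.encode c)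
      have hts : t ≤ s := by
        by_contra hcon
        exact hs ⟨t, by omega, by omega⟩
      have h1 := (haltingEnum_eq_two_mul ht).2.1
      rw [Denumerable.ofNat_encode] at h1
      have := Nat.unpair_right_le t
      exact evaln_isSome_mono (by omega) h1
    · intro hc
      obtain ⟨x, hx⟩ := Option.isSome_iff_exists.1 hc
      exact Part.dom_iff_mem.2 ⟨x, Code.evaln_sound hx⟩
  refine ComputablePred.computable_iff.2
    ⟨fun c => (Code.evaln (F (2 * Encodable.encode c)) c 0).isSome, ?_, ?_⟩
  · have hb : Computable fun c : Code => F (2 * Encodable.encode c) :=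
      hF.comp (Primrec.nat_mul.comp (Primrec.const 2) Primrec.encode).to_comp
    exact Primrec.option_isSome.to_comp.comp
      (Code.primrec_evaln.to_comp.comp ((hb.pair Computable.id).pair (Computable.const 0)))
  · funext c
    exact propext (hiff c)

/-- The ceer that collapses the deficient stages to one class and nothing else. -/
def deficiencyCeer (x y : ℕ) : Prop := x = y ∨ (Deficient x ∧ Deficient y)

theorem equivalence_deficiencyCeer : Equivalence deficiencyCeer where
  refl _ := Or.inl rfl
  symm := by
    rintro x y (rfl | ⟨hx, hy⟩)
    exacts [Or.inl rfl, Or.inr ⟨hy, hx⟩]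
  trans := by
    rintro x y z (rfl | ⟨hx, hy⟩) (rfl | ⟨hy', hz⟩)
    exacts [Or.inl rfl, Or.inr ⟨hy', hz⟩, Or.inr ⟨hx, hy⟩, Or.inr ⟨hx, hz⟩]

theorem eq_of_deficiencyCeer {x y : ℕ} (hx : ¬ Deficient x) (h : deficiencyCeer x y) : x = y :=
  h.resolve_right fun h => hx h.1

/-- An existential projection of a primitive recursive relation is computably enumerable. -/
theorem ceRel_of_primrecPred {E : ℕ → ℕ → Prop} (P : (ℕ × ℕ) × ℕ → Prop) [DecidablePred P]
    (hP : PrimrecPred P) (h : ∀ x y, E x y ↔ ∃ m, P ((x, y), m)) : CeRel E := by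
  have hr : Partrec fun p : ℕ × ℕ => Nat.rfind fun m => Part.some (decide (P (p, m))) :=
    Partrec.rfind (p := fun p m => Part.some (decide (P (p, m)))) hP.decide.to_comp.partrec
  have hm : Partrec fun p : ℕ × ℕ =>
      (Nat.rfind fun m => Part.some (decide (P (p, m)))).map fun _ => 0 :=
    hr.map (Computable.const 0).to₂
  refine hm.of_eq fun p => Part.ext' ?_ ?_
  · simp only [Part.assert, Part.map_Dom, h, Part.some_dom, exists_prop, and_true]
    refine Nat.rfind_dom.trans ⟨?_, ?_⟩
    · rintro ⟨m, hm, -⟩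
      exact ⟨m, by simpa using hm⟩
    · rintro ⟨m, hm⟩
      exact ⟨m, by simpa using hm, fun _ => trivial⟩
  · intros
    rfl

theorem ceer_deficiencyCeer : Ceer deficiencyCeer := by
  refine ⟨equivalence_deficiencyCeer, ceRel_of_primrecPred
    (fun q => q.1.1 = q.1.2 ∨
      ((q.1.1 < q.2.unpair.1 ∧ haltingEnum q.2.unpair.1 < haltingEnum q.1.1) ∧
        (q.1.2 < q.2.unpair.2 ∧ haltingEnum q.2.unpair.2 < haltingEnum q.1.2))) ?_ ?_⟩
  · have hx : Primrec fun q : (ℕ × ℕ) × ℕ => q.1.1 := Primrec.fst.comp Primrec.fst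
    have hy : Primrec fun q : (ℕ × ℕ) × ℕ => q.1.2 := Primrec.snd.comp Primrec.fst
    have hs : Primrec fun q : (ℕ × ℕ) × ℕ => q.2.unpair.1 :=
      Primrec.fst.comp (Primrec.unpair.comp Primrec.snd)
    have ht : Primrec fun q : (ℕ × ℕ) × ℕ => q.2.unpair.2 :=
      Primrec.snd.comp (Primrec.unpair.comp Primrec.snd)
    have hg := primrec_haltingEnum
    exact (Primrec.eq.comp hx hy).or
      (((Primrec.nat_lt.comp hx hs).and (Primrec.nat_lt.comp (hg.comp hs) (hg.comp hx))).and
        ((Primrec.nat_lt.comp hy ht).and (Primrec.nat_lt.comp (hg.comp ht) (hg.comp hy))))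
  · intro x y
    constructor
    · rintro (h | ⟨⟨s, hs⟩, ⟨t, ht⟩⟩)
      · exact ⟨0, Or.inl h⟩
      · exact ⟨Nat.pair s t, Or.inr (by simpa using ⟨hs, ht⟩)⟩
    · rintro ⟨m, h | ⟨hs, ht⟩⟩
      exacts [Or.inl h, Or.inr ⟨⟨_, hs⟩, ⟨_, ht⟩⟩]

theorem infinite_classes_deficiencyCeer :
    ¬ (Set.range fun x => {y | deficiencyCeer x y}).Finite := by
  intro hfin
  refine infinite_not_deficient (Set.Finite.of_finite_image
    (f := fun x => {y | deficiencyCeer x y}) (hfin.subset (Set.image_subset_range _ _)) ?_)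
  intro x hx y _ hxy
  refine eq_of_deficiencyCeer hx ?_
  have : y ∈ {z | deficiencyCeer y z} := Or.inl rfl
  rwa [← show {z | deficiencyCeer x z} = {z | deficiencyCeer y z} from hxy] at this

/-- A strict upper bound for the values of `u` below `n`. -/
def strictBound (u : ℕ → ℕ) : ℕ → ℕ
  | 0 => 0
  | n + 1 => strictBound u n + u n + 1

theorem lt_strictBound (u : ℕ → ℕ) {k n : ℕ} (h : k < n) : u k < strictBound u n := by
  induction n with
  | zero => omega
  | succ n ih =>
    rw [strictBound]
    rcases Nat.lt_succ_iff_lt_or_eq.1 h with h | rfl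
    · have := ih h
      omega
    · omega

theorem computable_strictBound {u : ℕ → ℕ} (hu : Computable u) :
    Computable (strictBound u) := by
  have hstep : Computable₂ fun (_ : ℕ) (p : ℕ × ℕ) => p.2 + u p.1 + 1 :=
    (Primrec.succ.to_comp.comp (Primrec.nat_add.to_comp.comp
      (Computable.snd.comp Computable.snd)
      (hu.comp (Computable.fst.comp Computable.snd)))).to₂
  refine (Computable.nat_rec Computable.id (Computable.const 0) hstep).of_eq fun n => ?_
  induction n with
  | zero => rfl
  | succ n ih =>
    simp only [id] at ih ⊢
    rw [strictBound, ← ih]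

/-- Iterated bounds: the numbers below `ballBound f m n` contain all those below `m`, and the
values of `f` on numbers below one stage lie below the next. -/
def ballBound (f : ℕ → ℕ → ℕ) (m : ℕ) : ℕ → ℕ
  | 0 => m
  | n + 1 => ballBound f m n +
      strictBound (fun k => f k.unpair.1 k.unpair.2) (ballBound f m n * ballBound f m n)

theorem computable_ballBound {f : ℕ → ℕ → ℕ} (hf : Computable₂ f) (m : ℕ) :
    Computable (ballBound f m) := by
  have hu : Computable fun k : ℕ => f k.unpair.1 k.unpair.2 :=
    hf.comp (Computable.fst.comp Computable.unpair) (Computable.snd.comp Computable.unpair)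
  have hp : Computable fun q : ℕ × ℕ × ℕ => q.2.2 := Computable.snd.comp Computable.snd
  have hstep : Computable₂ fun (_ : ℕ) (p : ℕ × ℕ) =>
      p.2 + strictBound (fun k => f k.unpair.1 k.unpair.2) (p.2 * p.2) :=
    (Primrec.nat_add.to_comp.comp hp
      ((computable_strictBound hu).comp (Primrec.nat_mul.to_comp.comp hp hp))).to₂
  refine (Computable.nat_rec Computable.id (Computable.const m) hstep).of_eq fun n => ?_
  induction n with
  | zero => rfl
  | succ n ih =>
    simp only [id] at ih ⊢
    rw [ballBound, ← ih]

theorem monotone_ballBound (f : ℕ → ℕ → ℕ) (m : ℕ) : Monotone (ballBound f m) :=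
  monotone_nat_of_le_succ fun _ => Nat.le_add_right _ _

theorem apply_lt_ballBound_succ (f : ℕ → ℕ → ℕ) (m n : ℕ) {a b : ℕ}
    (ha : a < ballBound f m n) (hb : b < ballBound f m n) : f a b < ballBound f m (n + 1) := by
  have hlt : Nat.pair a b < ballBound f m n * ballBound f m n := by
    refine (Nat.pair_lt_max_add_one_sq a b).trans_le ?_
    rw [pow_two]
    exact Nat.mul_le_mul (max_lt ha hb) (max_lt ha hb)
  have := lt_strictBound (fun k => f k.unpair.1 k.unpair.2) hlt
  simp only [Nat.unpair_pair] at this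
  rw [ballBound]
  omega

/-- If every element of the next stage is equivalent to one of the current stage, the current
stage meets every class. -/
theorem exists_lt_ballBound {f : ℕ → ℕ → ℕ} {E : ℕ → ℕ → Prop} {G : Finset ℕ} {m n : ℕ}
    (hE : Equivalence E) (hcong : CeerCongruence E f)
    (hgen : ∀ x : ℕ, ∃ y ∈ genClosure f ↑G, E x y) (hG : ∀ a ∈ G, a < m)
    (hstage : ∀ c < ballBound f m (n + 1), ∃ a < ballBound f m n, E c a) (x : ℕ) :
    ∃ a < ballBound f m n, E x a := by
  obtain ⟨y, hy, hxy⟩ := hgen x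
  obtain ⟨a, ha, hya⟩ : y ∈ {z | ∃ a < ballBound f m n, E z a} := by
    refine Set.mem_sInter.1 hy _ ⟨fun z hz => ?_, ?_⟩
    · exact ⟨z, (hG z hz).trans_le (monotone_ballBound f m (Nat.zero_le n)), hE.refl z⟩
    · rintro z ⟨a, ha, hza⟩ w ⟨b, hb, hwb⟩
      obtain ⟨c, hc, habc⟩ := hstage _ (apply_lt_ballBound_succ f m n ha hb)
      exact ⟨c, hc, hE.trans (hcong _ _ _ _ hza hwb) habc⟩
  exact ⟨a, ha, hE.trans hxy hya⟩

/-- Finitely many numbers cannot represent all the classes of a relation above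
`deficiencyCeer`. -/
theorem not_forall_exists_lt_of_reduces {E : ℕ → ℕ → Prop} (hE : Equivalence E)
    (hred : CeerReduces deficiencyCeer E) (M : ℕ) : ¬ ∀ x, ∃ a < M, E x a := by
  intro h
  obtain ⟨r, -, hr⟩ := hred
  choose a ha hEa using h
  obtain ⟨x, hx, y, -, hne, hxy⟩ := infinite_not_deficient.exists_ne_map_eq_of_mapsTo
    (f := fun x => a (r x)) (t := Set.Iio M) (fun x _ => ha (r x)) (Set.finite_Iio M)
  refine hne (eq_of_deficiencyCeer hx ((hr x y).2 (hE.trans (hEa (r x)) (hE.symm ?_))))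
  have := hEa (r y)
  rwa [← show a (r x) = a (r y) from hxy] at this

/-- Among `x + 3` numbers pairwise inequivalent under `deficiencyCeer`, one is non-deficient with
value above `x`. -/
theorem exists_not_deficient_lt {d : ℕ → ℕ}
    (hd : ∀ i j, i < j → ¬ deficiencyCeer (d j) (d i)) (x : ℕ) :
    ∃ i < x + 3, ¬ Deficient (d i) ∧ x < haltingEnum (d i) := by
  classical
  by_contra! hcon
  have hne : ∀ i j, deficiencyCeer (d i) (d j) → i = j := by
    intro i j h
    rcases lt_trichotomy i j with hij | hij | hij
    · exact absurd (equivalence_deficiencyCeer.symm h) (hd i j hij)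
    · exact hij
    · exact absurd h (hd j i hij)
  obtain ⟨i, hi, j, hj, hij, heq⟩ := Finset.exists_ne_map_eq_of_card_lt_of_maps_to
    (s := Finset.range (x + 3)) (t := Finset.range (x + 2))
    (f := fun i => if Deficient (d i) then x + 1 else haltingEnum (d i)) (by simp) (by
      intro i hi
      simp only [Finset.coe_range, Set.mem_Iio] at hi ⊢
      split_ifs with hdi
      · omega
      · have := hcon i hi hdi
        omega)
  rw [Finset.mem_range] at hi hj
  refine hij (hne i j ?_)
  split_ifs at heq with h1 h2 h2
  · exact Or.inr ⟨h1, h2⟩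
  · have := hcon j hj h2
    omega
  · have := hcon i hi h1
    omega
  · exact Or.inl (haltingEnum_injective heq)

/-- No class of finitely generated semigroups is ≡-complete for the ceers. -/
theorem stmt_11 :
    ∃ E : ℕ → ℕ → Prop, Ceer E ∧ ¬ (Set.range fun x => {y | E x y}).Finite ∧
      ∀ (f : ℕ → ℕ → ℕ) (E' : ℕ → ℕ → Prop) (G : Finset ℕ),
        Computable₂ f → Ceer E' → CeerCongruence E' f →
        (∀ a b c, E' (f (f a b) c) (f a (f b c))) →
        (∀ x : ℕ, ∃ y ∈ genClosure f ↑G, E' x y) →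
        ¬ (CeerReduces E E' ∧ CeerReduces E' E) := by
  refine ⟨deficiencyCeer, ceer_deficiencyCeer, infinite_classes_deficiencyCeer, ?_⟩
  rintro f E' G hf ⟨hE', -⟩ hcong - hgen ⟨hred, h, hh, hhE⟩
  obtain ⟨m, hm⟩ : ∃ m, ∀ a ∈ G, a < m :=
    ⟨G.sup id + 1, fun a ha => Nat.lt_succ_of_le (Finset.le_sup (f := id) ha)⟩
  have hnew : ∀ n, ∃ c < ballBound f m (n + 1), ∀ a < ballBound f m n, ¬ E' c a := by
    intro n
    by_contra! hcon
    exact not_forall_exists_lt_of_reduces hE' hred _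
      (exists_lt_ballBound hE' hcong hgen hm hcon)
  choose c hc hcE using hnew
  have hd : ∀ i j, i < j → ¬ deficiencyCeer (h (c j)) (h (c i)) := by
    intro i j hij hE
    exact hcE j (c i) ((hc i).trans_le (monotone_ballBound f m hij)) ((hhE _ _).2 hE)
  refine not_exists_computable_bound (fun x => strictBound h (ballBound f m (x + 3))) ?_ ?_
  · exact (computable_strictBound hh).comp ((computable_ballBound hf m).comp
      (Primrec.nat_add.comp Primrec.id (Primrec.const 3)).to_comp)
  · intro x
    obtain ⟨i, hi, hdi, hxi⟩ := exists_not_deficient_lt (d := fun i => h (c i)) hd x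
    exact ⟨h (c i), lt_strictBound h ((hc i).trans_le (monotone_ballBound f m hi)), hdi, hxi⟩
end

section
/- Let U and V be disjoint subsets of ℕ. In the free ring on countably many generators, realized as the monoid ring ℤ[X*] = MonoidAlgebra ℤ (FreeMonoid ℕ), let K be the two-sided ideal generated by the set {x_i : i ∈ U} ∪ {1 − x_j : j ∈ V}, where x_i denotes the image in the monoid ring of the generator i of the free monoid. Then: (a) 1 ∉ K (hence the classes of 0 and 1 modulo K are disjoint); (b) for every i ∈ ℕ, x_i ∈ K if and only if i ∈ U; and (c) for every j ∈ ℕ, 1 − x_j ∈ K if and only if j ∈ V. In particular the map i ↦ x_i is an m-reduction of the pair (U, V) to the pair ([0]_K, [1]_K). -/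
/-- The free ring on countably many generators, realized as the monoid ring of the
free monoid on ℕ over ℤ. -/
abbrev FreeRingN : Type := MonoidAlgebra ℤ (FreeMonoid ℕ)

/-- The image `x_i` in the monoid ring of the `i`-th generator of the free monoid. -/
noncomputable def xgen (i : ℕ) : FreeRingN :=
  MonoidAlgebra.of ℤ (FreeMonoid ℕ) (FreeMonoid.of i)

/-- The ring homomorphism from the free ring to `ℤ` sending `x_i` to `f i`. -/
noncomputable def evalHom (f : ℕ → ℤ) : FreeRingN →+* ℤ :=
  (MonoidAlgebra.lift ℤ ℤ (FreeMonoid ℕ) (FreeMonoid.lift f)).toRingHom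

theorem evalHom_xgen (f : ℕ → ℤ) (i : ℕ) : evalHom f (xgen i) = f i := by
  simp [evalHom, xgen]

/-- A ring homomorphism vanishing on `S` vanishes on the two-sided ideal generated by `S`. -/
theorem map_eq_zero_of_mem_span {R A : Type*} [Ring R] [Ring A] (φ : R →+* A) {S : Set R}
    (hS : ∀ s ∈ S, φ s = 0) {r : R} (hr : r ∈ TwoSidedIdeal.span S) : φ r = 0 := by
  have hle : TwoSidedIdeal.span S ≤ TwoSidedIdeal.ker φ :=
    TwoSidedIdeal.span_le.2 fun s hs => (TwoSidedIdeal.mem_ker φ).2 (hS s hs)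
  exact (TwoSidedIdeal.mem_ker φ).1 (hle hr)

/-- For disjoint `U, V ⊆ ℕ`, letting `K` be the two-sided ideal of `ℤ[X*]` generated by
`{x_i : i ∈ U} ∪ {1 - x_j : j ∈ V}`: (a) `1 ∉ K`; (b) `x_i ∈ K ↔ i ∈ U`;
(c) `1 - x_j ∈ K ↔ j ∈ V`. In particular `i ↦ x_i` m-reduces `(U, V)` to
`([0]_K, [1]_K)`. -/
theorem stmt_19 (U V : Set ℕ) (hUV : Disjoint U V)
    (K : TwoSidedIdeal FreeRingN)
    (hK : K = TwoSidedIdeal.span ((xgen '' U) ∪ ((fun j => 1 - xgen j) '' V))) :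
    (1 : FreeRingN) ∉ K ∧
    (∀ i : ℕ, xgen i ∈ K ↔ i ∈ U) ∧
    (∀ j : ℕ, 1 - xgen j ∈ K ↔ j ∈ V) ∧
    (∀ i : ℕ, (i ∈ U ↔ xgen i - 0 ∈ K) ∧ (i ∈ V ↔ xgen i - 1 ∈ K)) := by
  classical
  subst hK
  let f : ℕ → ℤ := fun i => if i ∈ U then 0 else if i ∈ V then 1 else 2
  have hker {r : FreeRingN} (hr : r ∈ TwoSidedIdeal.span
      ((xgen '' U) ∪ ((fun j => 1 - xgen j) '' V))) : evalHom f r = 0 := by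
    refine map_eq_zero_of_mem_span (evalHom f) ?_ hr
    rintro _ (⟨i, hi, rfl⟩ | ⟨j, hj, rfl⟩)
    · simp [evalHom_xgen, f, hi]
    · simp [evalHom_xgen, f, hj, hUV.notMem_of_mem_right hj]
  have hU (i : ℕ) : xgen i ∈ TwoSidedIdeal.span
      ((xgen '' U) ∪ ((fun j => 1 - xgen j) '' V)) ↔ i ∈ U := by
    refine ⟨fun h => ?_, fun h => TwoSidedIdeal.subset_span (Or.inl ⟨i, h, rfl⟩)⟩
    have h0 := hker h
    rw [evalHom_xgen] at h0
    grind
  have hV (j : ℕ) : 1 - xgen j ∈ TwoSidedIdeal.span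
      ((xgen '' U) ∪ ((fun j => 1 - xgen j) '' V)) ↔ j ∈ V := by
    refine ⟨fun h => ?_, fun h => TwoSidedIdeal.subset_span (Or.inr ⟨j, h, rfl⟩)⟩
    have h0 := hker h
    rw [map_sub, map_one, evalHom_xgen] at h0
    grind
  refine ⟨fun h => ?_, hU, hV, fun i => ⟨?_, ?_⟩⟩
  · simpa using hker h
  · rw [sub_zero, hU]
  · rw [← neg_sub, neg_mem_iff, hV]
end
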